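/- arXiv:1307.3042 — 3 statements merged into one kernel-verified Lean document; each statement's English description precedes it below -/
import Mathlib

section
/- Let A be a transcendental meromorphic function in the plane for which ∞ is a Borel exceptional value. Then A has the Wiman-Valiron property. -/
open Filter Set Topology Bornology MeasureTheory

noncomputable section

/-! ### The extended plane and the chordal metric

ℂ∞ is modelled as `Option ℂ`, with `none` denoting the point ∞. -/

/-- The chordal metric χ on the extended complex plane ℂ∞ (`none` = ∞). -/
def chordal : Option ℂ → Option ℂ → ℝ
  | Option.none, Option.none => 0
  | Option.none, Option.some w => 1 / Real.sqrt (1 + ‖w‖ ^ 2)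
  | Option.some z, Option.none => 1 / Real.sqrt (1 + ‖z‖ ^ 2)
  | Option.some z, Option.some w =>
      ‖z - w‖ / Real.sqrt ((1 + ‖z‖ ^ 2) * (1 + ‖w‖ ^ 2))

/-! ### Meromorphic functions in the plane -/

/-- `f` is meromorphic on the plane with pole set `P`: poles form a discrete closed set,
`f` is analytic off `P`, and `|f| → ∞` at each point of `P`. -/
def MeroPlane (f : ℂ → ℂ) (P : Set ℂ) : Prop :=
  (∀ K : Set ℂ, IsCompact K → (P ∩ K).Finite) ∧
  (∀ z ∉ P, AnalyticAt ℂ f z) ∧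
  ∀ p ∈ P, Tendsto (fun z => ‖f z‖) (nhdsWithin p Pᶜ) atTop

/-- `f` coincides with a rational function away from its poles. -/
def RationalFn (f : ℂ → ℂ) (P : Set ℂ) : Prop :=
  ∃ p q : Polynomial ℂ, q ≠ 0 ∧ ∀ z ∉ P, q.eval z ≠ 0 → f z = p.eval z / q.eval z

/-- `f` is a transcendental meromorphic function in the plane, with pole set `P`. -/
def TranscMeroPlane (f : ℂ → ℂ) (P : Set ℂ) : Prop :=
  MeroPlane f P ∧ ¬ RationalFn f P

/-- `f` has a pole of order `m` at `z₀`. -/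
def PoleOrder (f : ℂ → ℂ) (z₀ : ℂ) (m : ℕ) : Prop :=
  0 < m ∧ ∃ g : ℂ → ℂ, AnalyticAt ℂ g z₀ ∧ g z₀ ≠ 0 ∧
    ∀ᶠ z in nhdsWithin z₀ {z₀}ᶜ, f z = g z / (z - z₀) ^ m

/-- `f` has a zero of order `m` at `z₀`. -/
def ZeroOrder (f : ℂ → ℂ) (z₀ : ℂ) (m : ℕ) : Prop :=
  0 < m ∧ ∃ g : ℂ → ℂ, AnalyticAt ℂ g z₀ ∧ g z₀ ≠ 0 ∧
    ∀ᶠ z in nhds z₀, f z = (z - z₀) ^ m * g z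

/-- `z₀` is a multiple point of `f` of multiplicity `μ`: either a pole of `f` of order `μ ≥ 2`,
or a point of analyticity where `f'` has a zero of order `μ - 1`. -/
def MultiplePointWithMult (f : ℂ → ℂ) (z₀ : ℂ) (μ : ℕ) : Prop :=
  2 ≤ μ ∧ (PoleOrder f z₀ μ ∨ (AnalyticAt ℂ f z₀ ∧ ZeroOrder (deriv f) z₀ (μ - 1)))

/-- `z₀` is a multiple point of `f`. -/
def MultiplePoint (f : ℂ → ℂ) (z₀ : ℂ) : Prop :=
  ∃ μ, MultiplePointWithMult f z₀ μ

open scoped Classical in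
/-- The value of `f` at `z` as an element of ℂ∞, given the pole set `P`. -/
def valueAt (f : ℂ → ℂ) (P : Set ℂ) (z : ℂ) : Option ℂ :=
  if z ∈ P then none else some (f z)

/-- The set of critical values of `f` in ℂ∞ (values at multiple points). -/
def CriticalValues (f : ℂ → ℂ) (P : Set ℂ) : Set (Option ℂ) :=
  {w | ∃ z, MultiplePoint f z ∧ w = valueAt f P z}

/-! ### Transcendental singularities of the inverse function -/

/-- A path tending to infinity on which `f → a`; such a path determines a transcendental
singularity of `f⁻¹` over `a`. -/
def AsymptoticPath (f : ℂ → ℂ) (P : Set ℂ) (a : Option ℂ) (γ : ℝ → ℂ) : Prop :=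
  ContinuousOn γ (Ici 0) ∧
  Tendsto (fun t => ‖γ t‖) atTop atTop ∧
  Tendsto (fun t => chordal (valueAt f P (γ t)) a) atTop (nhds 0)

/-- `C` is a connected component of the set `S`. -/
def IsComponentOf (C S : Set ℂ) : Prop :=
  ∃ x ∈ S, C = connectedComponentIn S x

/-- The paths `γ₁`, `γ₂`, with asymptotic values `a₁`, `a₂` respectively, determine
distinct transcendental singularities of `f⁻¹`. -/
def DistinctSingularities (f : ℂ → ℂ) (P : Set ℂ) (a₁ a₂ : Option ℂ) (γ₁ γ₂ : ℝ → ℂ) : Prop :=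
  a₁ ≠ a₂ ∨ ∃ t : ℝ, 0 < t ∧ ∃ C₁ C₂ : Set ℂ,
    IsComponentOf C₁ {z | chordal (valueAt f P z) a₁ < t} ∧
    IsComponentOf C₂ {z | chordal (valueAt f P z) a₂ < t} ∧
    Disjoint C₁ C₂ ∧
    IsBounded (γ₁ '' Ici 0 \ C₁) ∧ IsBounded (γ₂ '' Ici 0 \ C₂)

/-- The inverse function of `f` has finitely many transcendental singularities: there is a
bound `n` on the size of any family of pairwise distinct transcendental singularities. -/
def FinitelyManyTranscSing (f : ℂ → ℂ) (P : Set ℂ) : Prop :=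
  ∃ n : ℕ, ∀ m : ℕ, ∀ a : Fin m → Option ℂ, ∀ γ : Fin m → ℝ → ℂ,
    (∀ i, AsymptoticPath f P (a i) (γ i)) →
    (∀ i j, i ≠ j → DistinctSingularities f P (a i) (a j) (γ i) (γ j)) →
    m ≤ n

/-- The Schwarzian derivative `S_f = f'''/f' - (3/2)(f''/f')²`. -/
def schwarzian (f : ℂ → ℂ) (z : ℂ) : ℂ :=
  deriv (deriv (deriv f)) z / deriv f z - (3 / 2) * (deriv (deriv f) z / deriv f z) ^ 2

/-- `w` is a singular value of `f⁻¹`: a critical value or an asymptotic value of `f`. -/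
def SingularValue (f : ℂ → ℂ) (P : Set ℂ) (w : Option ℂ) : Prop :=
  w ∈ CriticalValues f P ∨ ∃ γ : ℝ → ℂ, AsymptoticPath f P w γ

/-! ### Nevanlinna theory -/

open scoped Classical in
/-- The order of the pole of `f` at `z` (junk value `0` if there is no pole). -/
def poleOrderAt (f : ℂ → ℂ) (z : ℂ) : ℕ :=
  if h : ∃ m, PoleOrder f z m then h.choose else 0

/-- `n(t, f)`: the number of poles of `f` of modulus at most `t`, counted with multiplicity. -/
def nCount (f : ℂ → ℂ) (t : ℝ) : ℕ :=
  ∑ᶠ z ∈ {w : ℂ | ‖w‖ ≤ t}, poleOrderAt f z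

/-- `N(r, f)`: the integrated counting function of the poles of `f`. -/
def nevN (f : ℂ → ℂ) (r : ℝ) : ℝ :=
  (nCount f 0 : ℝ) * Real.log r + ∫ t in (0:ℝ)..r, ((nCount f t : ℝ) - (nCount f 0 : ℝ)) / t

/-- `m(r, f)`: the Nevanlinna proximity function. -/
def nevm (f : ℂ → ℂ) (r : ℝ) : ℝ :=
  (1 / (2 * Real.pi)) * ∫ θ in (0:ℝ)..(2 * Real.pi),
    Real.log (max 1 (‖f (r * Complex.exp (θ * Complex.I))‖))

/-- `T(r, f)`: the Nevanlinna characteristic. -/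
def nevT (f : ℂ → ℂ) (r : ℝ) : ℝ := nevm f r + nevN f r

/-- The order of growth `ρ(f) = limsup_{r→∞} log T(r,f)/log r`, as an extended real. -/
def growthOrder (f : ℂ → ℂ) : EReal :=
  Filter.limsup (fun r : ℝ => ((Real.log (nevT f r) / Real.log r : ℝ) : EReal)) atTop

/-- ∞ is a Borel exceptional value of `f`. -/
def BorelExceptionalInfty (f : ℂ → ℂ) : Prop :=
  Filter.limsup (fun r : ℝ => ((Real.log (nevN f r) / Real.log r : ℝ) : EReal)) atTop <
  Filter.limsup (fun r : ℝ => ((Real.log (nevT f r) / Real.log r : ℝ) : EReal)) atTop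

/-! ### Meromorphic functions near infinity and the Wiman-Valiron property -/

/-- `A` is meromorphic in `R ≤ |z| < ∞` with pole set `P`. -/
def MeroAnnulus (A : ℂ → ℂ) (R : ℝ) (P : Set ℂ) : Prop :=
  P ⊆ {z : ℂ | R ≤ ‖z‖} ∧
  (∀ K : Set ℂ, IsCompact K → (P ∩ K).Finite) ∧
  (∀ z : ℂ, R < ‖z‖ → z ∉ P → AnalyticAt ℂ A z) ∧
  ∀ p ∈ P, Tendsto (fun z => ‖A z‖) (nhdsWithin p Pᶜ) atTop

/-- `A` (meromorphic near ∞ with pole set `P`) has an essential singularity at infinity: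
it is not the case that the poles are bounded and `A(z) ~ c zⁿ` as `z → ∞`. -/
def EssSingAtInfty (A : ℂ → ℂ) (P : Set ℂ) : Prop :=
  ¬ (IsBounded P ∧ ∃ (n : ℤ) (c : ℂ), c ≠ 0 ∧
      Tendsto (fun z : ℂ => A z / z ^ n)
        (Filter.comap (fun z : ℂ => ‖z‖) atTop ⊓ Filter.principal Pᶜ) (nhds c))

/-- The logarithmic rectangle `D(z_r, L)` of Definition 2.1. -/
def WVDisk (z₀ : ℂ) (Nr phir L : ℝ) : Set ℂ :=
  {z : ℂ | ∃ τ : ℂ, z = z₀ * Complex.exp τ ∧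
    |τ.re| ≤ L * phir / Nr ∧ |τ.im| ≤ L * phir / Nr}

/-- Data witnessing the Wiman-Valiron property for `A`, meromorphic in `R ≤ |z| < ∞`:
an unbounded set `F1 ⊆ [R,∞)`, functions `N : F1 → [2,∞)`, `phi : F1 → [1,∞)` and points
`zr r` with `|zr r| = r`, such that `N(r) → ∞`, `phi(r)/N(r) → 0`, `phi(r)/log N(r) → ∞`,
`phi(r) = o(log⁺ |A(zr r)|)`, and `A(z) ~ (z/zr r)^{N(r)} A(zr r)` on `D(zr r, 8)`,
uniformly as `r → ∞` in `F1`.  (For `z = zr r · e^τ` one has `(z/zr r)^{N(r)} = e^{N(r)τ}`.) -/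
structure WVData (A : ℂ → ℂ) (R : ℝ) where
  F1 : Set ℝ
  N : ℝ → ℝ
  phi : ℝ → ℝ
  zr : ℝ → ℂ
  F1_sub : F1 ⊆ Ici R
  F1_unbounded : ∀ c : ℝ, ∃ r ∈ F1, c < r
  N_ge : ∀ r ∈ F1, 2 ≤ N r
  phi_ge : ∀ r ∈ F1, 1 ≤ phi r
  N_tendsto : Tendsto N (atTop ⊓ Filter.principal F1) atTop
  phi_over_N : Tendsto (fun r => phi r / N r) (atTop ⊓ Filter.principal F1) (nhds 0)
  phi_over_logN : Tendsto (fun r => phi r / Real.log (N r)) (atTop ⊓ Filter.principal F1) atTop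
  zr_abs : ∀ r ∈ F1, ‖zr r‖ = r
  phi_small : Tendsto (fun r => phi r / Real.log (max 1 (‖A (zr r)‖)))
      (atTop ⊓ Filter.principal F1) (nhds 0)
  approx : ∀ ε : ℝ, 0 < ε → ∀ᶠ r in atTop ⊓ Filter.principal F1, ∀ τ : ℂ,
      |τ.re| ≤ 8 * phi r / N r → |τ.im| ≤ 8 * phi r / N r →
      ‖A (zr r * Complex.exp τ) - Complex.exp ((N r : ℂ) * τ) * A (zr r)‖
        ≤ ε * ‖Complex.exp ((N r : ℂ) * τ) * A (zr r)‖

/-- `A` has the Wiman-Valiron property (Definition 2.1). -/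
def HasWVProp (A : ℂ → ℂ) (R : ℝ) : Prop := Nonempty (WVData A R)

/-- The point `w_r = z_r exp(-4 phi(r)/N(r))`. -/
def WVwr {A : ℂ → ℂ} {R : ℝ} (W : WVData A R) (r : ℝ) : ℂ :=
  W.zr r * Complex.exp (((-(4 * W.phi r / W.N r) : ℝ) : ℂ))

/-- The quantity `Z_r = |2 z_r A(z_r)^{1/2} / (N(r)+2)|`. -/
def WVZr {A : ℂ → ℂ} {R : ℝ} (W : WVData A R) (r : ℝ) : ℝ :=
  2 * r * Real.sqrt (‖A (W.zr r)‖) / (W.N r + 2)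

/-- The data of an analytic branch `sqA r` of `A^{1/2}` on `D(z_r, 4)` together with the
primitive `Z r` of `A^{1/2}` with `Z r (w_r) = 2 w_r A(w_r)^{1/2}/(N+2)`; this encodes
`Z(z) = 2 w_r A(w_r)^{1/2}/(N+2) + ∫_{w_r}^z A(t)^{1/2} dt`. -/
def IsZData {A : ℂ → ℂ} {R : ℝ} (W : WVData A R) (sqA Z : ℝ → ℂ → ℂ) (r : ℝ) : Prop :=
  (∀ z ∈ WVDisk (W.zr r) (W.N r) (W.phi r) 4,
      (sqA r z) ^ 2 = A z ∧ AnalyticAt ℂ (sqA r) z ∧ HasDerivAt (Z r) (sqA r z) z) ∧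
  Z r (WVwr W r) = 2 * WVwr W r * sqA r (WVwr W r) / ((W.N r : ℂ) + 2)

/-- The closed logarithmic rectangle `J₁ = {Z : |log|Z/Z_r|| ≤ phi(r), |arg Z| ≤ π/4}`. -/
def J1 (Zr phir : ℝ) : Set ℂ :=
  {w : ℂ | w ≠ 0 ∧ |Real.log (‖w‖ / Zr)| ≤ phir ∧ |Complex.arg w| ≤ Real.pi / 4}

/-! ### ε-sets -/

/-- An ε-set: a countable union of discs `B(b_j, ρ_j)` with `|b_j| → ∞` and
`Σ ρ_j/|b_j| < ∞`. -/
def IsEpsilonSet (E : Set ℂ) : Prop :=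
  ∃ (b : ℕ → ℂ) (ρ : ℕ → ℝ), (∀ j, 0 ≤ ρ j) ∧
    Tendsto (fun j => ‖b j‖) atTop atTop ∧
    Summable (fun j => ρ j / ‖b j‖) ∧
    E = ⋃ j, Metric.ball (b j) (ρ j)

lemma mp_punct {A : ℂ → ℂ} {P : Set ℂ} (hA : MeroPlane A P) (p : ℂ) :
    ∀ᶠ z in 𝓝[≠] p, z ∉ P := by
  have h1 := hA.1 _ (isCompact_closedBall p 1)
  have h2 : ((P ∩ Metric.closedBall p 1) \ {p}).Finite := h1.subset sdiff_subset
  have h3 : ((P ∩ Metric.closedBall p 1) \ {p})ᶜ ∈ 𝓝 p :=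
    h2.isClosed.isOpen_compl.mem_nhds (by simp)
  have h4 : Metric.closedBall p 1 ∈ 𝓝 p := Metric.closedBall_mem_nhds p one_pos
  filter_upwards [mem_nhdsWithin_of_mem_nhds h3, mem_nhdsWithin_of_mem_nhds h4,
    self_mem_nhdsWithin] with z hz1 hz2 hz3 hz4
  exact hz1 ⟨⟨hz4, hz2⟩, hz3⟩

lemma mp_tendsto {A : ℂ → ℂ} {P : Set ℂ} (hA : MeroPlane A P) {p : ℂ} (hp : p ∈ P) :
    Tendsto (fun z => ‖A z‖) (𝓝[≠] p) atTop := by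
  refine (hA.2.2 p hp).mono_left ?_
  rw [nhdsWithin, nhdsWithin]
  refine le_inf inf_le_left ?_
  rw [le_principal_iff]
  exact mp_punct hA p

lemma mp_pole {A : ℂ → ℂ} {P : Set ℂ} (hA : MeroPlane A P) {p : ℂ} (hp : p ∈ P) :
    ∃ m, PoleOrder A p m := by
  classical
  have ht := mp_tendsto hA hp
  set h : ℂ → ℂ := Function.update (fun z => (A z)⁻¹) p 0 with hh
  have hev : ∀ᶠ z in 𝓝[≠] p, h z = (A z)⁻¹ := by
    filter_upwards [self_mem_nhdsWithin] with z hz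
    simp only [hh]; rw [Function.update_of_ne hz]
  have hne : ∀ᶠ z in 𝓝[≠] p, A z ≠ 0 := by
    filter_upwards [ht.eventually_gt_atTop 0] with z hz
    exact norm_pos_iff.1 hz
  have hcont : ContinuousAt h p := by
    rw [hh, continuousAt_update_same]
    have := tendsto_inv_atTop_zero.comp ht
    rw [tendsto_zero_iff_norm_tendsto_zero]
    simpa [Function.comp_def] using this
  have hpu : ∀ᶠ z in 𝓝[≠] p, ∀ᶠ w in 𝓝 z, h w = (A w)⁻¹ := by
    filter_upwards [self_mem_nhdsWithin] with z hz
    filter_upwards [isOpen_compl_singleton.mem_nhds hz] with w hw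
    simp only [hh]; rw [Function.update_of_ne hw]
  have hd : ∀ᶠ z in 𝓝[≠] p, DifferentiableAt ℂ h z := by
    filter_upwards [hpu, hne, mp_punct hA p] with z hz1 hz2 hz3
    exact (((hA.2.1 z hz3).differentiableAt).inv hz2).congr_of_eventuallyEq hz1
  have han : AnalyticAt ℂ h p :=
    Complex.analyticAt_of_differentiable_on_punctured_nhds_of_continuousAt hd hcont
  have hnz : ¬ ∀ᶠ z in 𝓝 p, h z = 0 := by
    intro hz
    have : ∀ᶠ z in 𝓝[≠] p, False := by
      filter_upwards [hz.filter_mono nhdsWithin_le_nhds, hev, hne] with z h1 h2 h3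
      rw [h2] at h1
      exact h3 (inv_eq_zero.1 h1)
    exact (this.exists).elim fun _ h => h
  obtain ⟨n, g, hg, hg0, hge⟩ := han.exists_eventuallyEq_pow_smul_nonzero_iff.2 hnz
  have hn : 0 < n := by
    rcases Nat.eq_zero_or_pos n with h0 | h0
    · exfalso
      have := hge.self_of_nhds
      simp [h0, hh] at this
      exact hg0 this.symm
    · exact h0
  refine ⟨n, hn, fun z => (g z)⁻¹, hg.inv hg0, inv_ne_zero hg0, ?_⟩
  filter_upwards [hge.filter_mono nhdsWithin_le_nhds, hev] with z h1 h2
  rw [h2] at h1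
  rw [← inv_inv (A z), h1, smul_eq_mul, mul_inv, div_eq_mul_inv, mul_comm]

lemma not_pole_of_analytic {A : ℂ → ℂ} {z : ℂ} (h : AnalyticAt ℂ A z) (m : ℕ) :
    ¬ PoleOrder A z m := by
  rintro ⟨hm, g, hg, hg0, he⟩
  have h1 : Tendsto (fun w => A w * (w - z) ^ m) (𝓝[≠] z) (𝓝 (A z * (z - z) ^ m)) := by
    have : ContinuousAt (fun w => A w * (w - z) ^ m) z := h.continuousAt.mul (by fun_prop)
    exact this.tendsto.mono_left nhdsWithin_le_nhds
  have h2 : Tendsto g (𝓝[≠] z) (𝓝 (g z)) := hg.continuousAt.tendsto.mono_left nhdsWithin_le_nhds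
  have h3 : (fun w => A w * (w - z) ^ m) =ᶠ[𝓝[≠] z] g := by
    filter_upwards [he, self_mem_nhdsWithin] with w hw hw2
    have : w - z ≠ 0 := sub_ne_zero.2 hw2
    rw [hw]; field_simp
  have := tendsto_nhds_unique (h1.congr' h3) h2
  simp [hm.ne'] at this
  exact hg0 this.symm

lemma poleOrderAt_spec {A : ℂ → ℂ} {P : Set ℂ} (hA : MeroPlane A P) {p : ℂ} (hp : p ∈ P) :
    PoleOrder A p (poleOrderAt A p) := by
  have h := mp_pole hA hp
  rw [poleOrderAt, dif_pos h]
  exact h.choose_spec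

lemma poleOrderAt_zero {A : ℂ → ℂ} {P : Set ℂ} (hA : MeroPlane A P) {p : ℂ} (hp : p ∉ P) :
    poleOrderAt A p = 0 := by
  rw [poleOrderAt, dif_neg]
  rintro ⟨m, hm⟩
  exact not_pole_of_analytic (hA.2.1 p hp) m hm

lemma finite_poles {A : ℂ → ℂ} {P : Set ℂ} (hA : MeroPlane A P) (t : ℝ) :
    (P ∩ {w : ℂ | ‖w‖ ≤ t}).Finite := by
  have := hA.1 _ (isCompact_closedBall (0:ℂ) t)
  refine this.subset ?_
  rintro z ⟨h1, h2⟩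
  exact ⟨h1, by simpa using h2⟩

lemma nCount_eq {A : ℂ → ℂ} {P : Set ℂ} (hA : MeroPlane A P) (t : ℝ) :
    nCount A t = ∑ p ∈ (finite_poles hA t).toFinset, poleOrderAt A p := by
  rw [nCount]
  refine finsum_mem_eq_sum_of_inter_support_eq _ ?_
  ext z
  simp only [mem_inter_iff, Function.mem_support, Finite.coe_toFinset, mem_ofPred_eq]
  constructor
  · rintro ⟨h1, h2⟩
    refine ⟨⟨?_, h1⟩, h2⟩
    by_contra h
    exact h2 (poleOrderAt_zero hA h)
  · rintro ⟨⟨h1, h2⟩, h3⟩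
    exact ⟨h2, h3⟩

lemma exists_f {A : ℂ → ℂ} {P : Set ℂ} (hA : MeroPlane A P) (ρ : ℝ) :
    ∃ (F : Finset ℂ) (m : ℂ → ℕ) (f : ℂ → ℂ), (∀ p ∈ F, ‖p‖ ≤ ρ ∧ 0 < m p ∧ p ∈ P) ∧
      (∀ p ∈ P, ‖p‖ ≤ ρ → p ∈ F) ∧ ∑ p ∈ F, m p = nCount A ρ ∧
      DifferentiableOn ℂ f (Metric.ball 0 ρ) ∧
      ∀ z ∈ Metric.ball (0:ℂ) ρ, z ∉ F → f z = A z * ∏ p ∈ F, (z - p) ^ m p := by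
  classical
  set F := (finite_poles hA ρ).toFinset with hF
  have hFm : ∀ p, p ∈ F ↔ p ∈ P ∧ ‖p‖ ≤ ρ := by intro p; simp [hF]
  set G : ℂ → ℂ := fun z => A z * ∏ p ∈ F, (z - p) ^ poleOrderAt A p with hG
  set f : ℂ → ℂ := fun z => if z ∈ F then limUnder (𝓝[≠] z) G else G z with hf
  refine ⟨F, poleOrderAt A, f, ?_, ?_, (nCount_eq hA ρ).symm, ?_, ?_⟩
  · intro p hp
    exact ⟨((hFm p).1 hp).2, (poleOrderAt_spec hA ((hFm p).1 hp).1).1, ((hFm p).1 hp).1⟩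
  · intro p h1 h2
    exact (hFm p).2 ⟨h1, h2⟩
  · intro z hz
    refine DifferentiableAt.differentiableWithinAt ?_
    by_cases hzF : z ∈ F
    · obtain ⟨hm, g, hg, hg0, he⟩ := poleOrderAt_spec hA ((hFm z).1 hzF).1
      set H : ℂ → ℂ := fun w => g w * ∏ p ∈ F.erase z, (w - p) ^ poleOrderAt A p with hH
      have hHd : DifferentiableAt ℂ H z := by
        refine hg.differentiableAt.mul ?_
        fun_prop
      have hGH : G =ᶠ[𝓝[≠] z] H := by
        filter_upwards [he, self_mem_nhdsWithin] with w hw hw2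
        have : w - z ≠ 0 := sub_ne_zero.2 hw2
        simp only [hG, hH]
        rw [← Finset.mul_prod_erase F _ hzF, hw]
        field_simp
      have hlim : limUnder (𝓝[≠] z) G = H z := by
        refine Tendsto.limUnder_eq ?_
        exact (hHd.continuousAt.tendsto.mono_left nhdsWithin_le_nhds).congr' hGH.symm
      have hFcl : ((F.erase z : Finset ℂ) : Set ℂ)ᶜ ∈ 𝓝 z :=
        (F.erase z).finite_toSet.isClosed.isOpen_compl.mem_nhds (by simp)
      have : f =ᶠ[𝓝 z] H := by
        have hGH2 := eventually_nhdsWithin_iff.1 hGH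
        filter_upwards [hGH2, hFcl] with w h1 h3
        by_cases h2 : w = z
        · simp only [hf]; rw [h2, if_pos hzF, hlim]
        · rw [← h1 h2]
          simp only [hf]
          rw [if_neg]
          intro hw
          exact h3 (Finset.mem_coe.2 (Finset.mem_erase.2 ⟨h2, hw⟩))
      exact hHd.congr_of_eventuallyEq this
    · have hzP : z ∉ P := fun h => hzF ((hFm z).2 ⟨h, by simpa using (mem_ball_zero_iff.1 hz).le⟩)
      have hFcl : ((F : Finset ℂ) : Set ℂ)ᶜ ∈ 𝓝 z :=
        F.finite_toSet.isClosed.isOpen_compl.mem_nhds (by simpa using hzF)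
      have : f =ᶠ[𝓝 z] G := by
        filter_upwards [hFcl] with w hw
        simp only [hf]
        rw [if_neg (by simpa using hw)]
      refine DifferentiableAt.congr_of_eventuallyEq ?_ this
      refine (hA.2.1 z hzP).differentiableAt.mul ?_
      fun_prop
  · intro z hz hzF
    simp only [hf]
    rw [if_neg hzF]

lemma nCount_mono {A : ℂ → ℂ} {P : Set ℂ} (hA : MeroPlane A P) : Monotone (nCount A) := by
  intro s t hst
  rw [nCount_eq hA, nCount_eq hA]
  refine Finset.sum_le_sum_of_subset ?_
  intro z
  simp only [Finite.mem_toFinset, mem_inter_iff, mem_ofPred_eq]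
  exact fun h => ⟨h.1, h.2.trans hst⟩

lemma nCount_small {A : ℂ → ℂ} {P : Set ℂ} (hA : MeroPlane A P) :
    ∃ δ > 0, ∀ t, 0 ≤ t → t < δ → nCount A t = nCount A 0 := by
  have h := eventually_nhdsWithin_iff.1 (mp_punct hA 0)
  obtain ⟨δ, hδ, hb⟩ := Metric.eventually_nhds_iff.1 h
  refine ⟨δ, hδ, fun t ht0 ht => ?_⟩
  rw [nCount_eq hA, nCount_eq hA]
  refine Finset.sum_congr ?_ fun _ _ => rfl
  ext z
  simp only [Finite.mem_toFinset, mem_inter_iff, mem_ofPred_eq]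
  constructor
  · rintro ⟨h1, h2⟩
    refine ⟨h1, ?_⟩
    by_contra h3
    have hz : z ≠ 0 := by rintro rfl; simp at h3
    exact hb (by simpa using lt_of_le_of_lt h2 ht) hz h1
  · exact fun h => ⟨h.1, h.2.trans ht0⟩

lemma nInt {A : ℂ → ℂ} {P : Set ℂ} (hA : MeroPlane A P) {r : ℝ} (hr : 0 ≤ r) :
    IntervalIntegrable (fun t => ((nCount A t : ℝ) - (nCount A 0 : ℝ)) / t) volume 0 r := by
  obtain ⟨δ, hδ, hs⟩ := nCount_small hA
  rw [intervalIntegrable_iff_integrableOn_Ioc_of_le hr]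
  have hmono : Monotone (fun t : ℝ => (nCount A t : ℝ)) := fun s t h => by
    exact Nat.cast_le.2 (nCount_mono hA h)
  have hmeas : Measurable (fun t => ((nCount A t : ℝ) - (nCount A 0 : ℝ)) / t) :=
    (hmono.measurable.sub_const _).div measurable_id
  refine Measure.integrableOn_of_bounded (M := (nCount A r : ℝ) / δ) (by simp)
    hmeas.aestronglyMeasurable ?_
  refine (ae_restrict_iff' measurableSet_Ioc).2 (Eventually.of_forall fun t ht => ?_)
  have h0 : (nCount A 0 : ℝ) ≤ nCount A t := hmono ht.1.le
  have h1 : (nCount A t : ℝ) ≤ nCount A r := hmono ht.2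
  have h2 : (0:ℝ) ≤ nCount A 0 := by positivity
  rw [Real.norm_eq_abs, abs_div, abs_of_pos ht.1, abs_of_nonneg (by linarith)]
  rcases lt_or_ge t δ with h | h
  · rw [hs t ht.1.le h, sub_self, zero_div]; positivity
  · have := ht.1
    gcongr
    linarith

lemma nevN_lower {A : ℂ → ℂ} {P : Set ℂ} (hA : MeroPlane A P) {t : ℝ} (ht : 1 ≤ t) :
    (nCount A t : ℝ) * Real.log 2 ≤ nevN A (2 * t) := by
  have hmono : Monotone (fun t : ℝ => (nCount A t : ℝ)) := fun s t h => by
    exact Nat.cast_le.2 (nCount_mono hA h)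
  rw [nevN]
  have i1 := nInt hA (r := t) (by linarith)
  have i2 : IntervalIntegrable (fun t => ((nCount A t : ℝ) - (nCount A 0 : ℝ)) / t) volume t (2*t) :=
    i1.symm.trans (nInt hA (r := 2 * t) (by linarith))
  rw [← intervalIntegral.integral_add_adjacent_intervals i1 i2]
  have e1 : 0 ≤ ∫ u in (0:ℝ)..t, ((nCount A u : ℝ) - (nCount A 0 : ℝ)) / u := by
    refine intervalIntegral.integral_nonneg (by linarith) fun u hu => ?_
    have : (nCount A 0 : ℝ) ≤ nCount A u := hmono hu.1
    exact div_nonneg (by linarith) hu.1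
  have e2 : ((nCount A t : ℝ) - nCount A 0) * Real.log 2 ≤
      ∫ u in t..(2*t), ((nCount A u : ℝ) - (nCount A 0 : ℝ)) / u := by
    have : ∫ u in t..(2*t), ((nCount A t : ℝ) - nCount A 0) * u⁻¹ =
        ((nCount A t : ℝ) - nCount A 0) * Real.log 2 := by
      rw [intervalIntegral.integral_const_mul, integral_inv_of_pos (by linarith) (by linarith)]
      congr 2
      field_simp
    rw [← this]
    refine intervalIntegral.integral_mono_on (by linarith) ?_ i2 fun u hu => ?_
    · refine IntervalIntegrable.const_mul ?_ _
      refine intervalIntegral.intervalIntegrable_inv (fun x hx => ?_) continuousOn_id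
      rw [uIcc_of_le (by linarith)] at hx
      have := hx.1
      exact (by linarith : (0:ℝ) < x).ne'
    · have h1 : (nCount A t : ℝ) ≤ nCount A u := hmono hu.1
      have h2 : 0 < u := by linarith [hu.1]
      rw [div_eq_mul_inv]
      gcongr
  have e3 : (nCount A 0 : ℝ) * Real.log 2 ≤ nCount A 0 * Real.log (2 * t) := by
    gcongr
    linarith
  nlinarith

lemma nevN_nonneg {A : ℂ → ℂ} {P : Set ℂ} (hA : MeroPlane A P) {t : ℝ} (ht : 2 ≤ t) :
    0 ≤ nevN A t := by
  have := nevN_lower hA (t := t / 2) (by linarith)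
  rw [mul_div_cancel₀ _ (two_ne_zero)] at this
  refine le_trans ?_ this
  have := Real.log_nonneg (one_le_two)
  positivity

lemma nevm_le {A : ℂ → ℂ} {F : Finset ℂ} {m : ℂ → ℕ} {f : ℂ → ℂ} {r X : ℝ} (hr : 1 ≤ r)
    (hX : 0 ≤ X) (hF : ∀ p ∈ F, ‖p‖ ≤ 23 * r - 1 - r)
    (hf : ∀ z, ‖z‖ = r → z ∉ F → f z = A z * ∏ p ∈ F, (z - p) ^ m p)
    (hM : ∀ z, ‖z‖ = r → ‖f z‖ ≤ Real.exp X) :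
    nevm A r ≤ X + (∑ p ∈ F, m p : ℕ) * Real.log 23 := by
  have hl23 : 0 ≤ Real.log 23 := Real.log_nonneg (by norm_num)
  have hcm : ∀ θ : ℝ, (r : ℂ) * Complex.exp (θ * Complex.I) = circleMap 0 r θ := by
    intro θ; rw [circleMap_zero]
  rw [nevm]
  simp_rw [hcm]
  set g : ℝ → ℝ := fun θ => X + ∑ p ∈ F, (m p : ℝ) * (Real.log (23 * r) - Real.log ‖circleMap 0 r θ - p‖)
    with hg
  have hci : ∀ p : ℂ, IntervalIntegrable (fun θ => Real.log ‖circleMap 0 r θ - p‖) volume 0 (2 * Real.pi) :=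
    fun p => circleIntegrable_log_norm_sub_const (a := p) (c := 0) r
  have hpi := Real.two_pi_pos
  have hgi : IntervalIntegrable g volume 0 (2 * Real.pi) := by
    refine intervalIntegrable_const.add ?_
    have := IntervalIntegrable.sum F (μ := volume) (a := 0) (b := 2 * Real.pi)
      (f := fun p θ => (m p : ℝ) * (Real.log (23 * r) - Real.log ‖circleMap 0 r θ - p‖))
      (fun p _ => (intervalIntegrable_const.sub (hci p)).const_mul _)
    simpa [Finset.sum_fn] using this
  have hgint : ∫ θ in (0:ℝ)..(2 * Real.pi), g θ ≤ 2 * Real.pi * (X + (∑ p ∈ F, m p : ℕ) * Real.log 23) := by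
    simp only [hg]
    rw [intervalIntegral.integral_add intervalIntegrable_const, intervalIntegral.integral_finsetSum]
    · simp only [intervalIntegral.integral_const_mul, intervalIntegral.integral_const, smul_eq_mul, sub_zero]
      rw [mul_add]
      refine add_le_add le_rfl ?_
      push_cast
      rw [Finset.sum_mul, Finset.mul_sum]
      refine Finset.sum_le_sum fun p hp => ?_
      rw [intervalIntegral.integral_sub intervalIntegrable_const (hci p)]
      simp only [intervalIntegral.integral_const, smul_eq_mul, sub_zero]
      have hav := circleAverage_log_norm_sub_const_eq_log_radius_add_posLog (a := p) (c := 0) (R := r) (by linarith)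
      rw [Real.circleAverage_def, smul_eq_mul] at hav
      have h2 : ∫ θ in (0:ℝ)..(2 * Real.pi), Real.log ‖circleMap 0 r θ - p‖ ≥ 2 * Real.pi * Real.log r := by
        rw [inv_mul_eq_iff_eq_mul₀ (by positivity)] at hav
        rw [hav]
        have := Real.posLog_nonneg (x := r⁻¹ * ‖0 - p‖)
        rw [ge_iff_le]
        gcongr
        linarith
      have h3 : Real.log (23 * r) = Real.log 23 + Real.log r := Real.log_mul (by norm_num) (by linarith)
      have : 2 * Real.pi * ((m p : ℝ) * Real.log 23) = m p * (2 * Real.pi * Real.log (23 * r) - 2 * Real.pi * Real.log r) := by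
        rw [h3]; ring
      rw [this]
      gcongr
    · intro p _
      exact (intervalIntegrable_const.sub (hci p)).const_mul _
    · have := IntervalIntegrable.sum F (μ := volume) (a := 0) (b := 2 * Real.pi)
        (f := fun p θ => (m p : ℝ) * (Real.log (23 * r) - Real.log ‖circleMap 0 r θ - p‖))
        (fun p _ => (intervalIntegrable_const.sub (hci p)).const_mul _)
      simpa [Finset.sum_fn] using this
  have hterm : ∀ z : ℂ, ‖z‖ = r → ∀ p ∈ F, Real.log ‖z - p‖ ≤ Real.log (23 * r) := by
    intro z hz p hp
    rcases eq_or_ne (‖z - p‖) 0 with h0 | h0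
    · rw [h0, Real.log_zero]; exact Real.log_nonneg (by linarith)
    · refine Real.log_le_log (by positivity) ?_
      have := norm_sub_le z p
      have := hF p hp
      linarith
  have hg0 : ∀ θ, 0 ≤ g θ := by
    intro θ
    refine add_nonneg hX (Finset.sum_nonneg fun p hp => mul_nonneg (by positivity) ?_)
    have := hterm (circleMap 0 r θ) (by simp; linarith) p hp
    linarith
  have hpt : ∀ θ, circleMap 0 r θ ∉ F → Real.log (max 1 ‖A (circleMap 0 r θ)‖) ≤ g θ := by
    intro θ hθ
    have hz : ‖circleMap 0 r θ‖ = r := by simp; linarith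
    have h1 := hf _ hz hθ
    have h2 := hM _ hz
    rcases le_total ‖A (circleMap 0 r θ)‖ 1 with h | h
    · rw [max_eq_left h, Real.log_one]; exact hg0 θ
    · rw [max_eq_right h]
      have hQ : ∀ p ∈ F, ‖circleMap 0 r θ - p‖ ≠ 0 := by
        intro p hp h0
        rw [norm_eq_zero, sub_eq_zero] at h0
        exact hθ (h0 ▸ hp)
      have h3 : Real.log ‖f (circleMap 0 r θ)‖ = Real.log ‖A (circleMap 0 r θ)‖ +
          ∑ p ∈ F, (m p : ℝ) * Real.log ‖circleMap 0 r θ - p‖ := by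
        rw [h1, norm_mul, norm_prod, Real.log_mul (by linarith), Real.log_prod]
        · simp
        · intro p hp; rw [norm_pow]; exact pow_ne_zero _ (hQ p hp)
        · refine Finset.prod_ne_zero_iff.2 fun p hp => ?_
          rw [norm_pow]; exact pow_ne_zero _ (hQ p hp)
      have h4 : Real.log ‖f (circleMap 0 r θ)‖ ≤ X := by
        rcases eq_or_ne (‖f (circleMap 0 r θ)‖) 0 with h0 | h0
        · rw [h0, Real.log_zero]; exact hX
        · rw [Real.log_le_iff_le_exp (by positivity)]; exact h2
      have h5 : 0 ≤ ∑ p ∈ F, (m p : ℝ) * Real.log (23 * r) :=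
        Finset.sum_nonneg fun p _ => mul_nonneg (by positivity) (Real.log_nonneg (by linarith))
      simp only [hg, mul_sub, Finset.sum_sub_distrib]
      linarith
  have hmain : ∫ θ in (0:ℝ)..(2 * Real.pi), Real.log (max 1 ‖A (circleMap 0 r θ)‖) ≤
      ∫ θ in (0:ℝ)..(2 * Real.pi), g θ := by
    by_cases hi : IntervalIntegrable (fun θ => Real.log (max 1 ‖A (circleMap 0 r θ)‖)) volume 0 (2 * Real.pi)
    · refine intervalIntegral.integral_mono_ae hpi.le hi hgi ?_
      have hcount : (circleMap 0 r ⁻¹' (F : Set ℂ)).Countable :=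
        F.countable_toSet.preimage_circleMap 0 (by linarith)
      filter_upwards [hcount.ae_notMem volume] with θ hθ
      exact hpt θ hθ
    · rw [intervalIntegral.integral_undef hi]
      exact intervalIntegral.integral_nonneg hpi.le fun θ _ => hg0 θ
  calc 1 / (2 * Real.pi) * _ ≤ 1 / (2 * Real.pi) * (2 * Real.pi * (X + (∑ p ∈ F, m p : ℕ) * Real.log 23)) := by
        gcongr; exact hmain.trans hgint
    _ = _ := by field_simp

def hfun (f : ℂ → ℂ) (C σ : ℝ) (z : ℂ) : ℝ := ‖f z‖ * expNegInvGlue ((σ - Real.log ‖z‖) / C)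

def IsTouch (f : ℂ → ℂ) (C σ : ℝ) (z : ℂ) : Prop :=
  1 ≤ ‖z‖ ∧ ‖z‖ ≤ Real.exp σ ∧ ∀ w, 1 ≤ ‖w‖ → ‖w‖ ≤ Real.exp σ →
    hfun f C σ w ≤ hfun f C σ z ∧ (hfun f C σ w = hfun f C σ z → ‖z‖ ≤ ‖w‖)

lemma touch_exists {f : ℂ → ℂ} {ρ C σ : ℝ} (hf : DifferentiableOn ℂ f (Metric.ball 0 ρ))
    (hσ : 0 ≤ σ) (hσρ : Real.exp σ < ρ) : ∃ z, IsTouch f C σ z := by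
  set K : Set ℂ := {z | 1 ≤ ‖z‖ ∧ ‖z‖ ≤ Real.exp σ} with hK
  have hKc : IsCompact K := by
    refine (isCompact_closedBall (0:ℂ) (Real.exp σ)).of_isClosed_subset ?_ ?_
    · exact (isClosed_le continuous_const continuous_norm).inter
        (isClosed_le continuous_norm continuous_const)
    · intro z hz; simpa using hz.2
  have hKne : K.Nonempty := ⟨1, by simp [hK, Real.one_le_exp hσ]⟩
  have hcont : ContinuousOn (hfun f C σ) K := by
    unfold hfun
    refine ContinuousOn.mul ?_ ?_
    · refine (hf.continuousOn.mono ?_).norm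
      intro z hz
      simpa using lt_of_le_of_lt hz.2 hσρ
    · refine (expNegInvGlue.contDiff (n := 0)).continuous.comp_continuousOn ?_
      refine (continuousOn_const.sub ?_).div_const _
      refine continuous_norm.continuousOn.log ?_
      intro z hz
      have := hz.1
      positivity
  obtain ⟨z0, hz0, hmax⟩ := hKc.exists_isMaxOn hKne hcont
  have hK2 : IsCompact (K ∩ hfun f C σ ⁻¹' {hfun f C σ z0}) :=
    hKc.of_isClosed_subset (hcont.preimage_isClosed_of_isClosed hKc.isClosed isClosed_singleton)
      inter_subset_left
  obtain ⟨z, hz, hmin⟩ := hK2.exists_isMinOn ⟨z0, hz0, rfl⟩ continuous_norm.continuousOn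
  refine ⟨z, hz.1.1, hz.1.2, fun w h1 h2 => ⟨?_, fun h => ?_⟩⟩
  · have e : hfun f C σ z = hfun f C σ z0 := hz.2
    rw [e]; exact hmax ⟨h1, h2⟩
  · exact hmin ⟨⟨h1, h2⟩, h.trans hz.2⟩

lemma three_circ {f : ℂ → ℂ} {ρ x1 x2 a b : ℝ} {w w' : ℂ}
    (hf : DifferentiableOn ℂ f (Metric.ball 0 ρ)) (hρ : Real.exp x2 < ρ) (hx : x1 < x2)
    (hw0 : w ≠ 0) (hw0' : w' ≠ 0)
    (hw1 : x1 ≤ Real.log ‖w‖) (hw2 : Real.log ‖w‖ ≤ x2) (hw' : Real.log ‖w'‖ = x1 + x2 - Real.log ‖w‖)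
    (ha0 : 0 ≤ a) (hb0 : 0 ≤ b)
    (ha : ∀ z, ‖z‖ = Real.exp x1 → ‖f z‖ ≤ a) (hb : ∀ z, ‖z‖ = Real.exp x2 → ‖f z‖ ≤ b) :
    ‖f w‖ * ‖f w'‖ ≤ a * b := by
  have hball : ∀ u : ℂ, u.re ≤ x2 → Complex.exp u ∈ Metric.ball (0:ℂ) ρ := by
    intro u hu
    rw [mem_ball_zero_iff, Complex.norm_exp]
    exact lt_of_le_of_lt (Real.exp_le_exp.2 hu) hρ
  have key : ∀ v : ℂ, v ≠ 0 → x1 ≤ Real.log ‖v‖ → Real.log ‖v‖ ≤ x2 →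
      ‖f v‖ ≤ a ^ (1 - (Real.log ‖v‖ - x1) / (x2 - x1)) * b ^ ((Real.log ‖v‖ - x1) / (x2 - x1)) := by
    intro v hv h1 h2
    have := Complex.HadamardThreeLines.norm_le_interp_of_mem_verticalClosedStrip'
      (f := fun u => f (Complex.exp u)) (z := Complex.log v) (a := a) (b := b) hx ?_ ?_ ?_ ?_ ?_
    · simpa [Complex.exp_log hv, Complex.log_re] using this
    · simp only [Complex.HadamardThreeLines.verticalClosedStrip, mem_preimage, Complex.log_re]
      exact ⟨h1, h2⟩
    · refine DifferentiableOn.diffContOnCl ?_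
      refine hf.comp Complex.differentiable_exp.differentiableOn ?_
      intro u hu
      rw [Complex.HadamardThreeLines.verticalStrip, Complex.closure_preimage_re, closure_Ioo hx.ne] at hu
      exact hball u hu.2
    · have hc := (isCompact_closedBall (0:ℂ) (Real.exp x2))
      have hcf : ContinuousOn (fun z => ‖f z‖) (Metric.closedBall (0:ℂ) (Real.exp x2)) :=
        (hf.continuousOn.mono (Metric.closedBall_subset_ball hρ)).norm
      refine (hc.bddAbove_image hcf).mono ?_
      rintro _ ⟨u, hu, rfl⟩
      refine ⟨Complex.exp u, ?_, rfl⟩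
      rw [mem_closedBall_zero_iff, Complex.norm_exp]
      exact Real.exp_le_exp.2 hu.2
    · intro u hu
      refine ha _ ?_
      rw [Complex.norm_exp]; rw [show u.re = x1 from hu]
    · intro u hu
      refine hb _ ?_
      rw [Complex.norm_exp]; rw [show u.re = x2 from hu]
  have k1 := key w hw0 hw1 hw2
  have k2 := key w' hw0' (by rw [hw']; linarith) (by rw [hw']; linarith)
  set θ := (Real.log ‖w‖ - x1) / (x2 - x1) with hθ
  have hd : 0 < x2 - x1 := by linarith
  have hθ' : (Real.log ‖w'‖ - x1) / (x2 - x1) = 1 - θ := by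
    rw [hw', hθ]; field_simp; ring
  have hθ0 : 0 ≤ θ := div_nonneg (by linarith) hd.le
  have hθ1 : θ ≤ 1 := (div_le_one hd).2 (by linarith)
  rw [hθ', sub_sub_cancel] at k2
  calc ‖f w‖ * ‖f w'‖ ≤ (a ^ (1 - θ) * b ^ θ) * (a ^ θ * b ^ (1 - θ)) := by gcongr
    _ = (a ^ (1 - θ) * a ^ θ) * (b ^ θ * b ^ (1 - θ)) := by ring
    _ = a * b := by
      rw [← Real.rpow_add_of_nonneg ha0 (by linarith) hθ0, ← Real.rpow_add_of_nonneg hb0 hθ0 (by linarith)]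
      simp

lemma exists_circ_max {f : ℂ → ℂ} {ρ x : ℝ}
    (hf : DifferentiableOn ℂ f (Metric.ball 0 ρ)) (hρ : Real.exp x < ρ) :
    ∃ w : ℂ, ‖w‖ = Real.exp x ∧ ∀ z, ‖z‖ = Real.exp x → ‖f z‖ ≤ ‖f w‖ := by
  have hc := isCompact_sphere (0:ℂ) (Real.exp x)
  have hne : (Metric.sphere (0:ℂ) (Real.exp x)).Nonempty :=
    NormedSpace.sphere_nonempty.2 (Real.exp_pos x).le
  have hcf : ContinuousOn (fun z => ‖f z‖) (Metric.sphere (0:ℂ) (Real.exp x)) :=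
    (hf.continuousOn.mono (Metric.sphere_subset_closedBall.trans
      (Metric.closedBall_subset_ball hρ))).norm
  obtain ⟨w, hw, hmax⟩ := hc.exists_isMaxOn hne hcf
  refine ⟨w, by simpa using hw, fun z hz => hmax (by simpa using hz)⟩

lemma touch_expand {f : ℂ → ℂ} {ρ C σ σ' : ℝ} {z z' : ℂ}
    (hf : DifferentiableOn ℂ f (Metric.ball 0 ρ)) (hσ : σ < σ') (hρ : Real.exp σ' < ρ)
    (hz : IsTouch f C σ z) (hz' : IsTouch f C σ' z') (hp : 0 < hfun f C σ z)
    (hp' : 0 < hfun f C σ' z') (hbig : σ' - σ ≤ Real.log ‖z'‖) :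
    σ' - σ ≤ Real.log ‖z'‖ - Real.log ‖z‖ := by
  by_contra! hcon
  have hz0 : 0 < ‖z‖ := by linarith [hz.1]
  have hz0' : 0 < ‖z'‖ := by linarith [hz'.1]
  have hlz : Real.log ‖z‖ ≤ σ := (Real.log_le_iff_le_exp hz0).2 hz.2.1
  have hlz' : Real.log ‖z'‖ ≤ σ' := (Real.log_le_iff_le_exp hz0').2 hz'.2.1
  have hlz0 : 0 ≤ Real.log ‖z‖ := Real.log_nonneg hz.1
  set s := Real.log ‖z‖ with hs
  set s' := Real.log ‖z'‖ with hs'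
  obtain ⟨w1, hw1, hm1⟩ := exists_circ_max (x := s' - (σ' - σ)) hf
    (lt_of_le_of_lt (Real.exp_le_exp.2 (by linarith)) hρ)
  obtain ⟨w2, hw2, hm2⟩ := exists_circ_max (x := s + (σ' - σ)) hf
    (lt_of_le_of_lt (Real.exp_le_exp.2 (by linarith)) hρ)
  have t1 := hz.2.2 w1 (by rw [hw1]; exact Real.one_le_exp (by linarith))
    (by rw [hw1]; exact Real.exp_le_exp.2 (by linarith))
  have t2 := hz'.2.2 w2 (by rw [hw2]; exact Real.one_le_exp (by linarith))
    (by rw [hw2]; exact Real.exp_le_exp.2 (by linarith))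
  have t1' : hfun f C σ w1 < hfun f C σ z := by
    refine lt_of_le_of_ne t1.1 fun h => ?_
    have := t1.2 h
    rw [hw1, ← Real.exp_log hz0, Real.exp_le_exp] at this
    linarith
  have t2' := t2.1
  unfold hfun at t1' t2' hp hp'
  rw [hw1, Real.log_exp, ← hs, show σ - (s' - (σ' - σ)) = σ' - s' by ring] at t1'
  rw [hw2, Real.log_exp, ← hs', show σ' - (s + (σ' - σ)) = σ - s by ring] at t2'
  rw [← hs] at hp
  rw [← hs'] at hp'
  set e1 := expNegInvGlue ((σ' - s') / C)
  set e2 := expNegInvGlue ((σ - s) / C)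
  have he1 : 0 < e1 := pos_of_mul_pos_right hp' (norm_nonneg _)
  have he2 : 0 < e2 := pos_of_mul_pos_right hp (norm_nonneg _)
  have h3 := three_circ (a := ‖f w1‖) (b := ‖f w2‖) (w := z) (w' := z') hf
    (x1 := s' - (σ' - σ)) (x2 := s + (σ' - σ))
    (lt_of_le_of_lt (Real.exp_le_exp.2 (by linarith)) hρ) (by linarith)
    (norm_pos_iff.1 hz0) (norm_pos_iff.1 hz0') (by linarith) (by linarith)
    (by rw [← hs, ← hs']; ring) (norm_nonneg _) (norm_nonneg _) hm1 hm2
  have h4 : (‖f w1‖ * e1) * (‖f w2‖ * e2) < (‖f z‖ * e2) * (‖f z'‖ * e1) := by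
    calc (‖f w1‖ * e1) * (‖f w2‖ * e2) ≤ (‖f w1‖ * e1) * (‖f z'‖ * e1) := by gcongr
      _ < (‖f z‖ * e2) * (‖f z'‖ * e1) := mul_lt_mul_of_pos_right t1' hp'
  have h5 : ‖f z‖ * ‖f z'‖ * (e1 * e2) ≤ ‖f w1‖ * ‖f w2‖ * (e1 * e2) := by gcongr
  nlinarith

lemma touch_approx {f : ℂ → ℂ} {ρ C σ y N R : ℝ} {z : ℂ}
    (hf : DifferentiableOn ℂ f (Metric.ball 0 ρ)) (hρ : Real.exp σ < ρ)
    (hz : IsTouch f C σ z) (hC : 0 < C) (hy : y = σ - Real.log ‖z‖) (hy0 : 0 < y)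
    (hN : N = C / y ^ 2) (hR0 : 0 < R) (hR : R ≤ y / 2) (hR2 : R ≤ Real.log ‖z‖) (hfz : f z ≠ 0)
    (τ : ℂ) (hτ : ‖τ‖ ≤ R / 2) :
    ‖f (z * Complex.exp τ) - Complex.exp (N * τ) * f z‖ ≤
      2 * (Real.exp (2 * N * R ^ 2 / y) - 1) * ‖Complex.exp (N * τ) * f z‖ := by
  have hz0 : 0 < ‖z‖ := by linarith [hz.1]
  have hN0 : 0 < N := by rw [hN]; positivity
  have hre : ∀ t : ℂ, t ∈ Metric.ball (0:ℂ) R → |t.re| < R := fun t ht =>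
    lt_of_le_of_lt (Complex.abs_re_le_norm t) (by simpa using ht)
  have hnorm : ∀ t : ℂ, ‖z * Complex.exp t‖ = Real.exp (Real.log ‖z‖ + t.re) := by
    intro t; rw [norm_mul, Complex.norm_exp, Real.exp_add, Real.exp_log hz0]
  have hbd : ∀ t ∈ Metric.ball (0:ℂ) R, ‖f (z * Complex.exp t)‖ ≤
      ‖f z‖ * Real.exp (N * t.re + 2 * N * R ^ 2 / y) := by
    intro t ht
    have h1 := abs_lt.1 (hre t ht)
    have h2 := (hz.2.2 (z * Complex.exp t) (by rw [hnorm]; exact Real.one_le_exp (by linarith))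
      (by rw [hnorm]; exact Real.exp_le_exp.2 (by linarith))).1
    unfold hfun at h2
    rw [hnorm, Real.log_exp, show σ - (Real.log ‖z‖ + t.re) = y - t.re by rw [hy]; ring, ← hy] at h2
    have hyt : 0 < y - t.re := by linarith
    have e1 : expNegInvGlue ((y - t.re) / C) = Real.exp (-(C / (y - t.re))) := by
      rw [expNegInvGlue, if_neg (not_le.2 (by positivity)), inv_div]
    have e2 : expNegInvGlue (y / C) = Real.exp (-(C / y)) := by
      rw [expNegInvGlue, if_neg (not_le.2 (by positivity)), inv_div]
    rw [e1, e2] at h2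
    have h3 : ‖f (z * Complex.exp t)‖ ≤ ‖f z‖ * Real.exp (C / (y - t.re) - C / y) := by
      have hE : Real.exp (C / (y - t.re) - C / y) =
          Real.exp (-(C / y)) * Real.exp (C / (y - t.re)) := by
        rw [← Real.exp_add]; ring_nf
      rw [Real.exp_neg (C / (y - t.re)), ← div_eq_mul_inv, div_le_iff₀ (Real.exp_pos _)] at h2
      rw [hE]
      linarith
    refine h3.trans ?_
    gcongr
    have h4 : C / (y - t.re) - C / y = N * t.re + N * t.re ^ 2 / (y - t.re) := by
      rw [hN]; field_simp; ring
    rw [h4]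
    have h5 : t.re ^ 2 ≤ R ^ 2 := sq_le_sq' h1.1.le h1.2.le
    have h6 : N * t.re ^ 2 / (y - t.re) ≤ N * R ^ 2 / (y / 2) := by
      gcongr
      linarith
    have h7 : N * R ^ 2 / (y / 2) = 2 * N * R ^ 2 / y := by field_simp
    linarith
  set η := 2 * N * R ^ 2 / y with hη
  have hη0 : 0 < η := by rw [hη]; positivity
  set g : ℂ → ℂ := fun t => f (z * Complex.exp t) * Complex.exp (-(N * t)) / f z - 1 with hg
  have hM : 0 < Real.exp η - 1 := by linarith [Real.add_one_lt_exp hη0.ne']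
  have hgd : DifferentiableOn ℂ g (Metric.ball 0 R) := by
    have : DifferentiableOn ℂ (fun t => f (z * Complex.exp t)) (Metric.ball 0 R) := by
      refine hf.comp (by fun_prop) ?_
      intro t ht
      have h1 := abs_lt.1 (hre t ht)
      rw [mem_ball_zero_iff, hnorm]
      exact lt_of_le_of_lt (Real.exp_le_exp.2 (by linarith)) hρ
    exact ((this.mul (by fun_prop)).div_const _).sub_const _
  have hmap : Set.MapsTo g (Metric.ball 0 R) {z | z.re ≤ Real.exp η - 1} := by
    intro t ht
    have h1 : ‖f (z * Complex.exp t) * Complex.exp (-(N * t)) / f z‖ ≤ Real.exp η := by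
      rw [norm_div, norm_mul, Complex.norm_exp, div_le_iff₀ (norm_pos_iff.2 hfz)]
      have h2 := hbd t ht
      have h3 : (-((N:ℂ) * t)).re = -(N * t.re) := by simp
      rw [h3]
      calc _ ≤ ‖f z‖ * Real.exp (N * t.re + η) * Real.exp (-(N * t.re)) := by gcongr
        _ = Real.exp η * ‖f z‖ := by
          rw [mul_assoc, ← Real.exp_add, mul_comm]; congr 2; ring
    have h2 := (Complex.re_le_norm _).trans h1
    show (g t).re ≤ _
    simp only [hg, Complex.sub_re, Complex.one_re]
    linarith
  have hτR : ‖τ‖ < R := by linarith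
  have hbc := Complex.borelCaratheodory_zero hM hgd hmap hR0 (z := τ) (by simpa using hτR)
    (by simp [hg, hfz])
  have h1 : ‖g τ‖ ≤ 2 * (Real.exp η - 1) := by
    refine hbc.trans ?_
    rw [div_le_iff₀ (by linarith)]
    have : ‖τ‖ ≤ R - ‖τ‖ := by linarith
    gcongr
  have h2 : f (z * Complex.exp τ) - Complex.exp (N * τ) * f z = g τ * (Complex.exp (N * τ) * f z) := by
    simp only [hg]
    have := Complex.exp_ne_zero (N * τ)
    rw [Complex.exp_neg]
    field_simp
  rw [h2, norm_mul]
  gcongr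

lemma harm_aux (K : ℕ) (S : Finset ℕ) (g : ℕ → ℕ) (hg : ∀ i ∈ S, 1 ≤ g i ∧ g i ≤ K)
    (hinj : ∀ i ∈ S, ∀ j ∈ S, g i = g j → i = j) :
    ∑ i ∈ S, ((g i : ℝ))⁻¹ ≤ 1 + Real.log K := by
  have h1 : ∑ i ∈ S, ((g i : ℝ))⁻¹ = ∑ k ∈ S.image g, ((k : ℝ))⁻¹ := by
    rw [Finset.sum_image]
    exact fun i hi j hj h => hinj i hi j hj h
  have h2 : ∑ k ∈ S.image g, ((k : ℝ))⁻¹ ≤ ∑ k ∈ Finset.Icc 1 K, ((k : ℝ))⁻¹ := by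
    refine Finset.sum_le_sum_of_subset_of_nonneg ?_ (fun _ _ _ => by positivity)
    intro k hk
    obtain ⟨i, hi, rfl⟩ := Finset.mem_image.1 hk
    exact Finset.mem_Icc.2 (hg i hi)
  have h3 := harmonic_le_one_add_log K
  rw [harmonic_eq_sum_Icc] at h3
  push_cast at h3
  linarith

lemma harm_two (K j : ℕ) (hj : j < K) :
    ∑ i ∈ (Finset.range K).erase j, (|(i:ℝ) - j|)⁻¹ ≤ 2 * (1 + Real.log K) := by
  rw [← Finset.sum_filter_add_sum_filter_not _ (fun i => i < j)]
  have h1 := harm_aux K (((Finset.range K).erase j).filter (fun i => i < j)) (fun i => j - i)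
    (by intro i hi; simp at hi; omega) (by intro i hi i' hi' h; simp at hi hi' h; omega)
  have h2 := harm_aux K (((Finset.range K).erase j).filter (fun i => ¬ i < j)) (fun i => i - j)
    (by intro i hi; simp at hi; omega) (by intro i hi i' hi' h; simp at hi hi' h; omega)
  have e1 : ∑ i ∈ ((Finset.range K).erase j).filter (fun i => i < j), (|(i:ℝ) - j|)⁻¹ =
      ∑ i ∈ ((Finset.range K).erase j).filter (fun i => i < j), (((j - i : ℕ) : ℝ))⁻¹ := by
    refine Finset.sum_congr rfl fun i hi => ?_
    simp at hi
    rw [Nat.cast_sub hi.2.le, abs_sub_comm, abs_of_nonneg]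
    have : (i:ℝ) ≤ j := by exact_mod_cast hi.2.le
    linarith
  have e2 : ∑ i ∈ ((Finset.range K).erase j).filter (fun i => ¬ i < j), (|(i:ℝ) - j|)⁻¹ =
      ∑ i ∈ ((Finset.range K).erase j).filter (fun i => ¬ i < j), (((i - j : ℕ) : ℝ))⁻¹ := by
    refine Finset.sum_congr rfl fun i hi => ?_
    simp at hi
    rw [Nat.cast_sub hi.2, abs_of_nonneg]
    have : (j:ℝ) ≤ i := by exact_mod_cast hi.2
    linarith
  rw [e1, e2]
  linarith

lemma avg_lemma (F : Finset ℂ) (m : ℂ → ℕ) (x : ℂ → ℝ) (s : ℕ → ℝ) (n : ℕ) (d : ℝ) (hd : 0 < d)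
    (hm : ∀ p ∈ F, 0 < m p) (hn : ∑ p ∈ F, m p = n)
    (hs : ∀ i j, i < j → j < 2 * n + 1 → ((j:ℝ) - i) * d ≤ s j - s i) :
    ∃ i < 2 * n + 1, (∀ p ∈ F, s i ≠ x p) ∧
      ∑ p ∈ F, (m p : ℝ) * |s i - x p|⁻¹ ≤ (4 / d) * (1 + Real.log ((2 * n + 1 : ℕ) : ℝ)) := by
  set K := 2 * n + 1 with hK
  have hex : ∀ p : ℂ, ∃ i ∈ Finset.range K, ∀ j ∈ Finset.range K, |s i - x p| ≤ |s j - x p| :=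
    fun p => Finset.exists_min_image (Finset.range K) _ ⟨0, by simp [hK]⟩
  choose I hI hImin using hex
  have hsep : ∀ i j, i < K → j < K → |(i:ℝ) - j| * d ≤ |s i - s j| := by
    intro i j hi hj
    rcases lt_trichotomy i j with h | h | h
    · have := hs i j h hj
      have h' : (i:ℝ) < j := by exact_mod_cast h
      rw [abs_sub_comm, abs_of_pos (by linarith), abs_sub_comm]
      exact this.trans (le_abs_self _)
    · simp [h]
    · have := hs j i h hi
      have h' : (j:ℝ) < i := by exact_mod_cast h
      rw [abs_of_pos (by linarith)]
      exact this.trans (le_abs_self _)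
  have hlow : ∀ p, ∀ i, i < K → |(i:ℝ) - I p| * d ≤ 2 * |s i - x p| := by
    intro p i hi
    have h1 := hsep i (I p) hi (Finset.mem_range.1 (hI p))
    have h2 := hImin p i (Finset.mem_range.2 hi)
    have h3 := abs_sub_le (s i) (x p) (s (I p))
    rw [abs_sub_comm (x p)] at h3
    linarith
  set G := Finset.range K \ F.image I with hG
  have hcF : F.card ≤ n := by
    rw [← hn, Finset.card_eq_sum_ones]
    exact Finset.sum_le_sum fun p hp => hm p hp
  have hcG : n + 1 ≤ G.card := by
    have h1 := Finset.le_card_sdiff (F.image I) (Finset.range K)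
    have h2 : (F.image I).card ≤ F.card := Finset.card_image_le
    rw [Finset.card_range] at h1
    rw [hG]; omega
  have hGne : G.Nonempty := Finset.card_pos.1 (by omega)
  have hpos : ∀ p ∈ F, ∀ i ∈ G, 0 < |(i:ℝ) - I p| := by
    intro p hp i hi
    rw [hG, Finset.mem_sdiff] at hi
    rw [abs_pos, sub_ne_zero]
    intro h
    apply hi.2
    have : i = I p := by exact_mod_cast h
    rw [this]; exact Finset.mem_image_of_mem _ hp
  have hGr : ∀ i ∈ G, i < K := fun i hi => by
    rw [hG, Finset.mem_sdiff] at hi; exact Finset.mem_range.1 hi.1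
  set Λ := 1 + Real.log (K : ℝ) with hΛ
  have hΛ0 : 0 ≤ Λ := by
    have : 0 ≤ Real.log (K:ℝ) := Real.log_natCast_nonneg K
    linarith
  have hsum : ∑ i ∈ G, ∑ p ∈ F, (m p : ℝ) * |s i - x p|⁻¹ ≤ ∑ i ∈ G, (4 / d) * Λ := by
    rw [Finset.sum_comm]
    have h1 : ∀ p ∈ F, ∑ i ∈ G, (m p : ℝ) * |s i - x p|⁻¹ ≤ (m p : ℝ) * ((4 / d) * Λ) := by
      intro p hp
      rw [← Finset.mul_sum]
      gcongr
      calc ∑ i ∈ G, |s i - x p|⁻¹ ≤ ∑ i ∈ G, (2 / d) * (|(i:ℝ) - I p|)⁻¹ := by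
            refine Finset.sum_le_sum fun i hi => ?_
            have h2 := hlow p i (hGr i hi)
            have h3 := hpos p hp i hi
            have h4 : |(i:ℝ) - I p| * d / 2 ≤ |s i - x p| := by linarith
            calc |s i - x p|⁻¹ ≤ (|(i:ℝ) - I p| * d / 2)⁻¹ := by gcongr
              _ = _ := by field_simp
        _ = (2 / d) * ∑ i ∈ G, (|(i:ℝ) - I p|)⁻¹ := by rw [Finset.mul_sum]
        _ ≤ (2 / d) * ∑ i ∈ (Finset.range K).erase (I p), (|(i:ℝ) - I p|)⁻¹ := by
            gcongr
            intro i hi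
            rw [Finset.mem_erase]
            refine ⟨fun h => ?_, Finset.mem_range.2 (hGr i hi)⟩
            have := hpos p hp i hi
            simp [h] at this
        _ ≤ (2 / d) * (2 * Λ) := by
            gcongr
            exact harm_two K (I p) (Finset.mem_range.1 (hI p))
        _ = (4 / d) * Λ := by ring
    refine (Finset.sum_le_sum h1).trans ?_
    rw [← Finset.sum_mul, Finset.sum_const, nsmul_eq_mul, ← Nat.cast_sum, hn]
    gcongr
    omega
  obtain ⟨i, hi, hle⟩ := Finset.exists_le_of_sum_le hGne hsum
  refine ⟨i, hGr i hi, fun p hp h => ?_, hle⟩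
  have h2 := hlow p i (hGr i hi)
  have h3 := hpos p hp i hi
  rw [h] at h2
  simp only [sub_self, abs_zero, mul_zero] at h2
  nlinarith

lemma ratio_bound {z p : ℂ} (hz : z ≠ 0) (h : Real.log ‖z‖ ≠ Real.log ‖p‖) :
    z ≠ p ∧ ‖z‖ / ‖z - p‖ ≤ 1 + |Real.log ‖z‖ - Real.log ‖p‖|⁻¹ := by
  have hne : z ≠ p := fun h' => h (by rw [h'])
  refine ⟨hne, ?_⟩
  have hz0 : 0 < ‖z‖ := norm_pos_iff.2 hz
  by_cases hp : p = 0
  · subst hp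
    rw [sub_zero, div_self hz0.ne']
    have : 0 ≤ |Real.log ‖z‖ - Real.log ‖(0:ℂ)‖|⁻¹ := by positivity
    linarith
  have hp0 : 0 < ‖p‖ := norm_pos_iff.2 hp
  have hzp : 0 < ‖z - p‖ := norm_pos_iff.2 (sub_ne_zero.2 hne)
  have hzp' := abs_norm_sub_norm_le z p
  set s := Real.log ‖z‖ with hs
  set x := Real.log ‖p‖ with hx
  have ez : ‖z‖ = Real.exp s := (Real.exp_log hz0).symm
  have ep : ‖p‖ = Real.exp x := (Real.exp_log hp0).symm
  rcases lt_or_gt_of_ne h with h | h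
  · have h1 : Real.exp x - Real.exp s ≤ ‖z - p‖ := by
      rw [← ez, ← ep]; rw [abs_sub_comm] at hzp'; exact (le_abs_self _).trans hzp'
    have h2 : Real.exp s * (x - s) ≤ Real.exp x - Real.exp s := by
      have h3 := Real.add_one_le_exp (x - s)
      have h4 : Real.exp x = Real.exp s * Real.exp (x - s) := by rw [← Real.exp_add]; ring_nf
      rw [h4]
      nlinarith [Real.exp_pos s]
    rw [abs_sub_comm, abs_of_pos (by linarith)]
    have h5 : 0 < x - s := by linarith
    have h6 : ‖z‖ / ‖z - p‖ ≤ (x - s)⁻¹ := by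
      rw [ez, div_le_iff₀ hzp, inv_mul_eq_div, le_div_iff₀ h5]
      linarith
    linarith
  · have h1 : Real.exp s - Real.exp x ≤ ‖z - p‖ := by
      rw [← ez, ← ep]; exact (le_abs_self _).trans hzp'
    have h5 : 0 < s - x := by linarith
    have h2 : Real.exp x * (1 + (s - x)) ≤ Real.exp s := by
      have h3 := Real.add_one_le_exp (s - x)
      have h4 : Real.exp s = Real.exp x * Real.exp (s - x) := by rw [← Real.exp_add]; ring_nf
      rw [h4]
      gcongr
      linarith
    rw [abs_of_pos h5, ez, div_le_iff₀ hzp]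
    have h7 : (1 + (s - x)⁻¹) = (1 + (s - x)) / (s - x) := by field_simp; ring
    rw [h7, div_mul_eq_mul_div, le_div_iff₀ h5]
    nlinarith [Real.exp_pos s]

lemma prod_ratio (F : Finset ℂ) (m : ℂ → ℕ) (z τ : ℂ) (W : ℝ) (hz : ∀ p ∈ F, z ≠ p)
    (hW : ∑ p ∈ F, (m p : ℝ) * (‖z‖ / ‖z - p‖) ≤ W) :
    ‖∏ p ∈ F, (z * Complex.exp τ - p) ^ m p - ∏ p ∈ F, (z - p) ^ m p‖ ≤
      (Real.exp (W * ‖Complex.exp τ - 1‖) - 1) * ‖∏ p ∈ F, (z - p) ^ m p‖ := by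
  set a : ℂ → ℂ := fun p => z * (Complex.exp τ - 1) / (z - p) with ha
  have h1 : ∏ p ∈ F, (z * Complex.exp τ - p) ^ m p =
      (∏ p ∈ F, (1 + a p) ^ m p) * ∏ p ∈ F, (z - p) ^ m p := by
    rw [← Finset.prod_mul_distrib]
    refine Finset.prod_congr rfl fun p hp => ?_
    rw [← mul_pow]
    congr 1
    have := sub_ne_zero.2 (hz p hp)
    simp only [ha]
    field_simp
    ring
  have h2 : ∏ p ∈ F, (1 + a p) ^ m p = ∏ x ∈ F.sigma (fun p => Finset.range (m p)), (1 + a x.1) := by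
    rw [Finset.prod_sigma]
    refine Finset.prod_congr rfl fun p hp => ?_
    simp
  have h3 : ∑ x ∈ F.sigma (fun p => Finset.range (m p)), ‖a x.1‖ =
      (∑ p ∈ F, (m p : ℝ) * (‖z‖ / ‖z - p‖)) * ‖Complex.exp τ - 1‖ := by
    rw [Finset.sum_sigma, Finset.sum_mul]
    refine Finset.sum_congr rfl fun p hp => ?_
    simp only [Finset.sum_const, Finset.card_range, nsmul_eq_mul, ha, norm_div, norm_mul]
    ring
  have h4 := Finset.norm_prod_one_add_sub_one_le (F.sigma (fun p => Finset.range (m p)))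
    (fun x => a x.1)
  rw [h1, h2, ← sub_one_mul, norm_mul]
  gcongr
  refine h4.trans ?_
  rw [h3]
  gcongr

lemma expneg_eq {x C : ℝ} (hx : 0 < x) (hC : 0 < C) :
    expNegInvGlue (x / C) = Real.exp (-(C / x)) := by
  rw [expNegInvGlue, if_neg (not_le.2 (by positivity)), inv_div]

lemma scale_step {A : ℂ → ℂ} {P : Set ℂ} (hA : MeroPlane A P) {r B C L M : ℝ} {n : ℕ}
    (hL : 3 ≤ L) (hLr : L ≤ r) (hn : nCount A (Real.exp 3 * r) = n)
    (hB : 0 ≤ B) (hC : 0 < C)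
    (hLP : ∀ z, ‖z‖ = L → z ∉ P ∧ ‖A z‖ ≤ M) (hM : 0 < M)
    (hgrow : B + C + n * Real.log 23 < nevm A r)
    (hsmall : M * (L + Real.exp 3 * r) ^ n < Real.exp B) :
    ∃ (F : Finset ℂ) (m : ℂ → ℕ) (f : ℂ → ℂ) (σ : ℝ) (z : ℂ),
      (∀ p ∈ F, ‖p‖ ≤ Real.exp 3 * r ∧ 0 < m p) ∧ ∑ p ∈ F, m p = n ∧
      DifferentiableOn ℂ f (Metric.ball 0 (Real.exp 3 * r)) ∧
      (∀ w ∈ Metric.ball (0:ℂ) (Real.exp 3 * r), w ∉ F → f w = A w * ∏ p ∈ F, (w - p) ^ m p) ∧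
      Real.exp σ < Real.exp 3 * r ∧ σ ≤ Real.log r + 2 ∧ IsTouch f C σ z ∧ L < ‖z‖ ∧
      0 < σ - Real.log ‖z‖ ∧ Real.exp (B + C / (σ - Real.log ‖z‖)) ≤ ‖f z‖ ∧
      (∀ p ∈ F, z ≠ p) ∧
      ∑ p ∈ F, (m p : ℝ) * (‖z‖ / ‖z - p‖) ≤
        n + 4 * (2 * n + 1) * (1 + Real.log (2 * n + 1)) := by
  have hr : 3 ≤ r := hL.trans hLr
  have hr0 : 0 < r := by linarith
  have he3 : Real.exp 3 < 21 := by
    have h1 := Real.exp_one_lt_d9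
    have h2 : Real.exp 3 = Real.exp 1 ^ 3 := by rw [← Real.exp_nat_mul]; norm_num
    rw [h2]
    calc Real.exp 1 ^ 3 ≤ 2.7182818286 ^ 3 := by gcongr
      _ < 21 := by norm_num
  have he3' : 1 < Real.exp 3 := Real.one_lt_exp_iff.2 (by norm_num)
  have hLρ : L < Real.exp 3 * r := by nlinarith
  obtain ⟨F, m, f, hF, hPF, hsum, hf, hfA⟩ := exists_f hA (Real.exp 3 * r)
  rw [hn] at hsum
  have hσρ : ∀ σ, σ ≤ Real.log r + 2 → Real.exp σ < Real.exp 3 * r := by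
    intro σ h
    calc Real.exp σ < Real.exp (3 + Real.log r) := Real.exp_lt_exp.2 (by linarith)
      _ = _ := by rw [Real.exp_add, Real.exp_log hr0]
  have hlr : 0 ≤ Real.log r := Real.log_nonneg (by linarith)
  -- large value
  obtain ⟨zs, hzs, hfzs⟩ : ∃ zs : ℂ, ‖zs‖ = r ∧ Real.exp (B + C) < ‖f zs‖ := by
    by_contra! hcon
    have := nevm_le (A := A) (F := F) (m := m) (f := f) (r := r) (X := B + C) (by linarith)
      (by linarith) (fun p hp => (hF p hp).1.trans (by nlinarith))
      (fun z hz hzF => hfA z (by rw [mem_ball_zero_iff, hz]; nlinarith) hzF) hcon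
    rw [hsum] at this
    linarith
  have hcirc : ∀ z : ℂ, ‖z‖ ≤ L → ‖f z‖ ≤ M * (L + Real.exp 3 * r) ^ n := by
    intro z hz
    refine Complex.norm_le_of_forall_mem_frontier_norm_le (U := Metric.ball (0:ℂ) L)
      Metric.isBounded_ball ?_ ?_ ?_
    · refine DifferentiableOn.diffContOnCl (hf.mono ?_)
      rw [closure_ball (0:ℂ) (by linarith)]
      exact Metric.closedBall_subset_ball hLρ
    · intro w hw
      rw [frontier_ball (0:ℂ) (by linarith), mem_sphere_zero_iff_norm] at hw
      have hwF : w ∉ F := fun h => (hLP w hw).1 (hF w h).2.2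
      rw [hfA w (by rw [mem_ball_zero_iff, hw]; exact hLρ) hwF, norm_mul]
      gcongr
      · exact (hLP w hw).2
      · rw [norm_prod, ← hsum, ← Finset.prod_pow_eq_pow_sum]
        refine Finset.prod_le_prod (fun _ _ => norm_nonneg _) fun p hp => ?_
        rw [norm_pow]
        gcongr
        refine (norm_sub_le _ _).trans ?_
        rw [hw]
        linarith [(hF p hp).1]
    · rw [closure_ball (0:ℂ) (by linarith)]
      simpa using hz
  have htouch : ∀ σ z, Real.log r + 1 ≤ σ → σ ≤ Real.log r + 2 → IsTouch f C σ z →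
      0 < hfun f C σ z ∧ L < ‖z‖ ∧ 0 < σ - Real.log ‖z‖ ∧
      Real.exp (B + C / (σ - Real.log ‖z‖)) ≤ ‖f z‖ := by
    intro σ z h1 h2 hz
    have hrσ : r ≤ Real.exp σ := by
      rw [← Real.log_le_iff_le_exp hr0]; linarith
    have h3 := (hz.2.2 zs (by rw [hzs]; linarith) (by rw [hzs]; exact hrσ)).1
    have h4 : Real.exp B < hfun f C σ zs := by
      rw [hfun, hzs, expneg_eq (by linarith) hC]
      have h5 : C / (σ - Real.log r) ≤ C := div_le_self hC.le (by linarith)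
      calc Real.exp B = Real.exp (B + C) * Real.exp (-C) := by rw [← Real.exp_add]; ring_nf
        _ < ‖f zs‖ * Real.exp (-C) := by gcongr
        _ ≤ _ := by gcongr
    have h5 : Real.exp B < hfun f C σ z := h4.trans_le h3
    have hpos : 0 < hfun f C σ z := (Real.exp_pos B).trans h5
    have h6 : 0 < expNegInvGlue ((σ - Real.log ‖z‖) / C) := by
      rw [hfun] at hpos
      exact pos_of_mul_pos_right hpos (norm_nonneg _)
    have hy : 0 < σ - Real.log ‖z‖ := by
      by_contra! hcon
      rw [expNegInvGlue.zero_of_nonpos (div_nonpos_of_nonpos_of_nonneg hcon hC.le)] at h6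
      exact lt_irrefl _ h6
    have h7 : Real.exp (B + C / (σ - Real.log ‖z‖)) ≤ ‖f z‖ := by
      rw [hfun, expneg_eq hy hC, Real.exp_neg, ← div_eq_mul_inv, lt_div_iff₀ (Real.exp_pos _),
        ← Real.exp_add] at h5
      exact h5.le
    refine ⟨hpos, ?_, hy, h7⟩
    by_contra! hcon
    have h8 := hcirc z hcon
    have h9 : Real.exp B ≤ Real.exp (B + C / (σ - Real.log ‖z‖)) :=
      Real.exp_le_exp.2 (by have : 0 < C / (σ - Real.log ‖z‖) := by positivity
                            linarith)
    linarith
  have hlog3 : 1 ≤ Real.log 3 := by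
    rw [Real.le_log_iff_exp_le (by norm_num)]
    linarith [Real.exp_one_lt_d9]
  set d : ℝ := 1 / (2 * n + 1) with hd
  have hd0 : 0 < d := by positivity
  set sg : ℕ → ℝ := fun i => Real.log r + 1 + (min i (2 * n + 1) : ℕ) * d with hsg
  have hsg1 : ∀ i, Real.log r + 1 ≤ sg i := fun i => by
    simp only [hsg]
    have : 0 ≤ ((min i (2 * n + 1) : ℕ) : ℝ) * d := by positivity
    linarith
  have hsg2 : ∀ i, sg i ≤ Real.log r + 2 := fun i => by
    simp only [hsg]
    have h1 : ((min i (2 * n + 1) : ℕ) : ℝ) ≤ 2 * n + 1 := by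
      exact_mod_cast min_le_right i (2 * n + 1)
    have h2 : ((min i (2 * n + 1) : ℕ) : ℝ) * d ≤ (2 * n + 1) * d := by gcongr
    have h3 : (2 * n + 1 : ℝ) * d = 1 := by rw [hd]; field_simp
    linarith
  have hex : ∀ i, ∃ z, IsTouch f C (sg i) z := fun i =>
    touch_exists hf (by linarith [hsg1 i]) (hσρ _ (hsg2 i))
  choose Z hZ using hex
  have hT := fun i => htouch (sg i) (Z i) (hsg1 i) (hsg2 i) (hZ i)
  obtain ⟨i, hi, hne, hle⟩ := avg_lemma F m (fun p => Real.log ‖p‖) (fun i => Real.log ‖Z i‖) n d hd0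
    (fun p hp => (hF p hp).2.1) hsum (by
      intro i j hij hj
      have e : sg j - sg i = ((j:ℝ) - i) * d := by
        simp only [hsg]
        rw [min_eq_left (by omega), min_eq_left (by omega)]
        ring
      have hij' : (i:ℝ) < j := by exact_mod_cast hij
      have e0 : 0 < ((j:ℝ) - i) * d := mul_pos (by linarith) hd0
      rw [← e]
      refine touch_expand hf (by linarith) (hσρ _ (hsg2 j)) (hZ i) (hZ j) (hT i).1 (hT j).1 ?_
      have h1 : Real.log 3 ≤ Real.log ‖Z j‖ :=
        Real.log_le_log (by norm_num) (by linarith [(hT j).2.1])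
      linarith [hsg1 i, hsg2 j])
  have hZ0 : Z i ≠ 0 := norm_pos_iff.1 (by linarith [(hZ i).1])
  refine ⟨F, m, f, sg i, Z i, fun p hp => ⟨(hF p hp).1, (hF p hp).2.1⟩, hsum, hf, hfA, hσρ _ (hsg2 i), hsg2 i,
    hZ i, (hT i).2.1, (hT i).2.2.1, (hT i).2.2.2, fun p hp => (ratio_bound hZ0 (hne p hp)).1, ?_⟩
  calc ∑ p ∈ F, (m p : ℝ) * (‖Z i‖ / ‖Z i - p‖)
      ≤ ∑ p ∈ F, ((m p : ℝ) + (m p : ℝ) * |Real.log ‖Z i‖ - Real.log ‖p‖|⁻¹) := by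
        refine Finset.sum_le_sum fun p hp => ?_
        have := (ratio_bound hZ0 (hne p hp)).2
        calc (m p : ℝ) * (‖Z i‖ / ‖Z i - p‖)
            ≤ (m p : ℝ) * (1 + |Real.log ‖Z i‖ - Real.log ‖p‖|⁻¹) := by gcongr
          _ = _ := by ring
    _ ≤ n + (4 / d) * (1 + Real.log ((2 * n + 1 : ℕ) : ℝ)) := by
        rw [Finset.sum_add_distrib, ← Nat.cast_sum, hsum]
        gcongr
    _ = _ := by
        rw [hd]
        push_cast
        field_simp

lemma scale_conc {A : ℂ → ℂ} {P : Set ℂ} (hA : MeroPlane A P) {r B C L M : ℝ} {n : ℕ}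
    (hL : 3 ≤ L) (hLr : L ≤ r) (hn : nCount A (Real.exp 3 * r) = n)
    (hB : 0 ≤ B) (hC : 0 < C)
    (hLP : ∀ z, ‖z‖ = L → z ∉ P ∧ ‖A z‖ ≤ M) (hM : 0 < M)
    (hgrow : B + C + n * Real.log 23 < nevm A r)
    (hsmall : M * (L + Real.exp 3 * r) ^ n < Real.exp B)
    (hsmall2 : (2 * Real.exp 3 * r) ^ n ≤ Real.exp B) :
    ∃ (z : ℂ) (y N : ℝ), L < ‖z‖ ∧ 0 < y ∧ y ≤ Real.log r + 2 ∧ N = C / y ^ 2 ∧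
      Real.exp (C / y) ≤ ‖A z‖ ∧
      ∀ δ R : ℝ, 0 < δ → δ ≤ 1 / 4 → 0 < R → R ≤ 1 → R ≤ y / 2 → 2 * N * R ^ 2 / y ≤ δ →
        (n + 4 * (2 * n + 1) * (1 + Real.log (2 * n + 1))) * R ≤ δ →
        ∀ τ : ℂ, ‖τ‖ ≤ R / 2 →
          ‖A (z * Complex.exp τ) - Complex.exp (N * τ) * A z‖ ≤
            12 * δ * ‖Complex.exp (N * τ) * A z‖ := by
  obtain ⟨F, m, f, σ, z, hF, hsum, hf, hfA, hσρ, hσ, hz, hLz, hy, hfz, hzF, hW⟩ :=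
    scale_step hA hL hLr hn hB hC hLP hM hgrow hsmall
  have hz0 : 0 < ‖z‖ := by linarith
  have hr0 : 0 < r := by linarith
  have hlz1 : 1 ≤ Real.log ‖z‖ := by
    rw [Real.le_log_iff_exp_le hz0]
    linarith [Real.exp_one_lt_d9]
  have hzball : z ∈ Metric.ball (0:ℂ) (Real.exp 3 * r) := by
    rw [mem_ball_zero_iff]; exact hz.2.1.trans_lt hσρ
  have hzF' : z ∉ F := fun h => hzF z h rfl
  set Q : ℂ → ℂ := fun w => ∏ p ∈ F, (w - p) ^ m p with hQ
  have hfz' : f z = A z * Q z := hfA z hzball hzF'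
  have hQ0 : Q z ≠ 0 := Finset.prod_ne_zero_iff.2 fun p hp => pow_ne_zero _ (sub_ne_zero.2 (hzF p hp))
  have hfz0 : f z ≠ 0 := norm_pos_iff.1 ((Real.exp_pos _).trans_le hfz)
  refine ⟨z, σ - Real.log ‖z‖, C / (σ - Real.log ‖z‖) ^ 2, hLz, hy, by linarith, rfl, ?_, ?_⟩
  · have h1 : ‖Q z‖ ≤ Real.exp B := by
      refine le_trans ?_ hsmall2
      simp only [hQ]
      rw [norm_prod, ← hsum, ← Finset.prod_pow_eq_pow_sum]
      refine Finset.prod_le_prod (fun _ _ => norm_nonneg _) fun p hp => ?_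
      rw [norm_pow]
      gcongr
      refine (norm_sub_le _ _).trans ?_
      have := mem_ball_zero_iff.1 hzball
      linarith [(hF p hp).1]
    rw [hfz', norm_mul, Real.exp_add, mul_comm] at hfz
    by_contra! hcon
    have h2 : ‖A z‖ * ‖Q z‖ ≤ ‖A z‖ * Real.exp B := by gcongr
    have h3 : ‖A z‖ * Real.exp B < Real.exp (C / (σ - Real.log ‖z‖)) * Real.exp B := by gcongr
    linarith
  · intro δ R hδ hδ4 hR0 hR1 hRy hη hWR τ hτ
    set N := C / (σ - Real.log ‖z‖) ^ 2 with hN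
    have h1 := touch_approx hf hσρ hz hC rfl hy hN hR0 hRy (hR1.trans hlz1) hfz0 τ hτ
    have h2 := prod_ratio F m z τ _ hzF hW
    have he1 : ‖Complex.exp τ - 1‖ ≤ R := by
      have := Complex.norm_exp_sub_one_le (x := τ) (by linarith)
      linarith
    have hW0 : 0 ≤ n + 4 * (2 * n + 1) * (1 + Real.log (2 * n + 1 : ℝ)) := by
      have : 0 ≤ Real.log (2 * n + 1 : ℝ) := Real.log_nonneg (by
        have : (0:ℝ) ≤ n := Nat.cast_nonneg n
        linarith)
      positivity
    set W := n + 4 * (2 * n + 1) * (1 + Real.log (2 * n + 1 : ℝ)) with hWdef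
    have hexpδ : Real.exp δ - 1 ≤ 2 * δ := by
      have := Real.abs_exp_sub_one_le (x := δ) (by rw [abs_of_pos hδ]; linarith)
      rw [abs_of_pos hδ] at this
      exact (le_abs_self _).trans this
    have h2' : ‖Q (z * Complex.exp τ) - Q z‖ ≤ 2 * δ * ‖Q z‖ := by
      refine h2.trans ?_
      gcongr
      refine le_trans ?_ hexpδ
      gcongr
      exact (mul_le_mul_of_nonneg_left he1 hW0).trans hWR
    have h1' : ‖f (z * Complex.exp τ) - Complex.exp (N * τ) * f z‖ ≤
        4 * δ * ‖Complex.exp (N * τ) * f z‖ := by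
      refine h1.trans ?_
      refine mul_le_mul_of_nonneg_right ?_ (norm_nonneg _)
      have : Real.exp (2 * N * R ^ 2 / (σ - Real.log ‖z‖)) ≤ Real.exp δ := Real.exp_le_exp.2 hη
      linarith
    have hQp : 0 < ‖Q z‖ := norm_pos_iff.2 hQ0
    have hQ' : ‖Q z‖ / 2 ≤ ‖Q (z * Complex.exp τ)‖ := by
      have h3 := norm_sub_norm_le (Q z) (Q z - Q (z * Complex.exp τ))
      rw [sub_sub_cancel, norm_sub_rev (Q z)] at h3
      nlinarith
    have hwF : z * Complex.exp τ ∉ F := by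
      intro h
      have : Q (z * Complex.exp τ) = 0 :=
        Finset.prod_eq_zero h (by rw [sub_self, zero_pow (hF _ h).2.ne'])
      rw [this, norm_zero] at hQ'
      linarith
    have hwb : z * Complex.exp τ ∈ Metric.ball (0:ℂ) (Real.exp 3 * r) := by
      rw [mem_ball_zero_iff, norm_mul, Complex.norm_exp]
      have h4 := (le_abs_self _).trans (Complex.abs_re_le_norm τ)
      calc ‖z‖ * Real.exp τ.re = Real.exp (Real.log ‖z‖ + τ.re) := by
            rw [Real.exp_add, Real.exp_log hz0]
        _ ≤ Real.exp σ := Real.exp_le_exp.2 (by linarith)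
        _ < _ := hσρ
    have hfw : f (z * Complex.exp τ) = A (z * Complex.exp τ) * Q (z * Complex.exp τ) :=
      hfA _ hwb hwF
    set E := Complex.exp (N * τ) with hE
    set A' := A (z * Complex.exp τ)
    set Q' := Q (z * Complex.exp τ)
    have key : (A' - E * A z) * Q' = (f (z * Complex.exp τ) - E * f z) - E * A z * (Q' - Q z) := by
      rw [hfw, hfz']; ring
    have key2 : ‖A' - E * A z‖ * ‖Q'‖ ≤ 6 * δ * ‖E * A z‖ * ‖Q z‖ := by
      rw [← norm_mul, key]
      refine (norm_sub_le _ _).trans ?_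
      rw [norm_mul (E * A z)]
      rw [hfz', ← mul_assoc, norm_mul (E * A z)] at h1'
      have : ‖E * A z‖ * ‖Q' - Q z‖ ≤ ‖E * A z‖ * (2 * δ * ‖Q z‖) := by gcongr
      rw [hfz', ← mul_assoc]
      linarith
    have key3 : ‖A' - E * A z‖ * (‖Q z‖ / 2) ≤ 6 * δ * ‖E * A z‖ * ‖Q z‖ :=
      (mul_le_mul_of_nonneg_left hQ' (norm_nonneg _)).trans key2
    have key4 : ‖A' - E * A z‖ * ‖Q z‖ ≤ (12 * δ * ‖E * A z‖) * ‖Q z‖ := by linarith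
    exact le_of_mul_le_mul_right key4 hQp

lemma exists_circle {A : ℂ → ℂ} {P : Set ℂ} (hA : MeroPlane A P) (k : ℝ) :
    ∃ L M : ℝ, k ≤ L ∧ 0 < M ∧ ∀ z, ‖z‖ = L → z ∉ P ∧ ‖A z‖ ≤ M := by
  have h1 := (finite_poles hA (k + 1)).image norm
  obtain ⟨L, hL, hL2⟩ := ((Set.Icc_infinite (show k < k + 1 by linarith)).sdiff h1).nonempty
  have hP : ∀ z : ℂ, ‖z‖ = L → z ∉ P := fun z hz hzP =>
    hL2 ⟨z, ⟨hzP, by rw [mem_ofPred_eq, hz]; exact hL.2⟩, hz⟩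
  have hc := isCompact_sphere (0:ℂ) L
  have hcf : ContinuousOn A (Metric.sphere (0:ℂ) L) := fun z hz =>
    (hA.2.1 z (hP z (by simpa using hz))).continuousAt.continuousWithinAt
  obtain ⟨M, hM⟩ := hc.exists_bound_of_continuousOn hcf
  refine ⟨L, max M 1, hL.1, by positivity, fun z hz => ⟨hP z hz, ?_⟩⟩
  exact (hM z (by simpa using hz)).trans (le_max_left _ _)

lemma log_pow_div (j : ℕ) {c : ℝ} (hc : 0 < c) :
    Tendsto (fun x : ℝ => Real.log x ^ j / x ^ c) atTop (𝓝 0) := by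
  have := (isLittleO_log_rpow_rpow_atTop (j:ℝ) hc).tendsto_div_nhds_zero
  simpa [Real.rpow_natCast] using this

lemma log_pow_le (j : ℕ) {c ε : ℝ} (hc : 0 < c) (hε : 0 < ε) :
    ∀ᶠ x : ℝ in atTop, Real.log x ^ j ≤ ε * x ^ c := by
  filter_upwards [(log_pow_div j hc).eventually (gt_mem_nhds hε), eventually_gt_atTop 0] with x h1 h2
  rw [div_lt_iff₀ (by positivity)] at h1
  exact h1.le

lemma N_asymp {θ δ : ℝ} (hθ0 : 0 < θ) (hθ : θ < 1) (hδ : 0 < δ) :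
    ∀ᶠ x : ℝ in atTop, 3 ≤ x ∧ 32 * Real.log x ^ 2 / x ≤ 1 ∧ 64 * Real.log x ^ 2 ≤ √x ∧
      2048 * Real.log x ^ 4 ≤ δ * √x ∧ Real.log x ^ 2 ≤ δ * √x ∧
      ∀ n : ℕ, (n:ℝ) ≤ x ^ θ →
        (n + 4 * (2 * n + 1) * (1 + Real.log (2 * n + 1))) * (32 * Real.log x ^ 2 / x) ≤ δ := by
  filter_upwards [eventually_ge_atTop 3,
    log_pow_le 2 (c := 1) (ε := 1 / 32) (by norm_num) (by norm_num),
    log_pow_le 2 (c := 1 / 2) (ε := 1 / 64) (by norm_num) (by norm_num),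
    log_pow_le 4 (c := 1 / 2) (ε := δ / 2048) (by norm_num) (by positivity),
    log_pow_le 2 (c := 1 / 2) (ε := δ) (by norm_num) (by positivity),
    log_pow_le 3 (c := 1 - θ) (ε := δ / 1600) (by linarith) (by positivity)] with x h0 h1 h2 h3 h4 h5
  have hx0 : 0 < x := by linarith
  rw [Real.rpow_one] at h1
  rw [← Real.sqrt_eq_rpow] at h2 h3 h4
  refine ⟨h0, ?_, by linarith, by linarith, h4, ?_⟩
  · rw [div_le_one hx0]; linarith
  · intro n hn
    have hl1 : 1 ≤ Real.log x := by
      rw [Real.le_log_iff_exp_le hx0]; linarith [Real.exp_one_lt_d9]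
    have hn0 : (0:ℝ) ≤ n := Nat.cast_nonneg n
    have hxθ : 1 ≤ x ^ θ := Real.one_le_rpow (by linarith) hθ0.le
    have hlog : Real.log (2 * n + 1) ≤ 2 * Real.log x := by
      calc Real.log (2 * n + 1) ≤ Real.log (3 * x ^ θ) :=
            Real.log_le_log (by linarith) (by linarith)
        _ = Real.log 3 + θ * Real.log x := by
            rw [Real.log_mul (by norm_num) (by positivity), Real.log_rpow hx0]
        _ ≤ 2 * Real.log x := by
            have := Real.log_le_log (by norm_num) h0
            nlinarith
    have hlog0 : 0 ≤ Real.log (2 * n + 1 : ℝ) := Real.log_nonneg (by linarith)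
    have hW : n + 4 * (2 * n + 1) * (1 + Real.log (2 * n + 1)) ≤ x ^ θ * (50 * Real.log x) := by
      calc n + 4 * (2 * n + 1) * (1 + Real.log (2 * n + 1))
          ≤ x ^ θ + 4 * (2 * x ^ θ + x ^ θ) * (Real.log x + 2 * Real.log x) := by gcongr
        _ = x ^ θ * (36 * Real.log x) + x ^ θ * 1 := by ring
        _ ≤ x ^ θ * (36 * Real.log x) + x ^ θ * (14 * Real.log x) := by gcongr; linarith
        _ = _ := by ring
    have hx1 : x = x ^ θ * x ^ (1 - θ) := by
      rw [← Real.rpow_add hx0]; simp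
    calc _ ≤ x ^ θ * (50 * Real.log x) * (32 * Real.log x ^ 2 / x) := by gcongr
      _ = 1600 * x ^ θ * Real.log x ^ 3 / x := by ring
      _ ≤ 1600 * x ^ θ * (δ / 1600 * x ^ (1 - θ)) / x := by gcongr
      _ = δ * (x ^ θ * x ^ (1 - θ)) / x := by ring
      _ = δ := by rw [← hx1]; field_simp

set_option maxHeartbeats 1000000 in
lemma main_scale {A : ℂ → ℂ} {P : Set ℂ} (hA : MeroPlane A P) {lam μ : ℝ} (hlam : 0 < lam)
    (hlm : lam < μ) (hN : ∀ᶠ r in atTop, nevN A r ≤ r ^ lam)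
    (hT : ∃ᶠ r in atTop, r ^ μ < nevT A r) (k : ℕ) :
    ∃ (z : ℂ) (N : ℝ), k < ‖z‖ ∧ k ≤ N ∧ 3 ≤ N ∧
      Real.log N ^ 2 / Real.log (max 1 ‖A z‖) ≤ 1 / (k + 1) ∧
      ∀ τ : ℂ, |τ.re| ≤ 8 * Real.log N ^ 2 / N → |τ.im| ≤ 8 * Real.log N ^ 2 / N →
        ‖A (z * Complex.exp τ) - Complex.exp (N * τ) * A z‖ ≤
          1 / (k + 1) * ‖Complex.exp (N * τ) * A z‖ := by
  obtain ⟨a, ha1, ha2⟩ := exists_between hlm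
  obtain ⟨b', hb1, hb2⟩ := exists_between ha2
  obtain ⟨b, hb3, hb4⟩ := exists_between hb2
  obtain ⟨L, M, hkL, hM, hLM⟩ := exists_circle hA (k + 3)
  have ha0 : 0 < a := hlam.trans ha1
  have hb'0 : 0 < b' := ha0.trans hb1
  have hk0 : (0:ℝ) ≤ k := Nat.cast_nonneg k
  set δ : ℝ := 1 / (48 * (k + 1)) with hδ
  have hδ0 : 0 < δ := by positivity
  have hδ4 : δ ≤ 1 / 4 := by
    rw [hδ]; gcongr; linarith
  have hδk : 12 * δ ≤ 1 / (k + 1) := by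
    rw [hδ, show (12:ℝ) * (1 / (48 * (k + 1))) = (1 / 4) * (1 / (k + 1)) by field_simp; norm_num]
    have : (0:ℝ) < 1 / (k + 1) := by positivity
    linarith
  obtain ⟨x0, hx0⟩ := eventually_atTop.1 ((N_asymp (θ := a / b') (by positivity)
    ((div_lt_one hb'0).2 hb1) hδ0).and (eventually_ge_atTop (k:ℝ)))
  have hlog2 : 0 < Real.log 2 := Real.log_pos (by norm_num)
  have hE1 : ∀ᶠ r : ℝ in atTop, (nCount A (Real.exp 3 * r) : ℝ) ≤ r ^ a := by
    have ht : Tendsto (fun r : ℝ => 2 * (Real.exp 3 * r)) atTop atTop :=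
      (tendsto_id.const_mul_atTop (Real.exp_pos 3)).const_mul_atTop (by norm_num)
    filter_upwards [ht.eventually hN, eventually_ge_atTop 1,
      (tendsto_rpow_atTop (sub_pos.2 ha1)).eventually_ge_atTop
        ((2 * Real.exp 3) ^ lam / Real.log 2)] with r h1 h2 h3
    have he : 1 ≤ Real.exp 3 := Real.one_le_exp (by norm_num)
    have h4 := nevN_lower hA (t := Real.exp 3 * r) (by nlinarith)
    rw [div_le_iff₀ hlog2] at h3
    have h5 : (2 * (Real.exp 3 * r)) ^ lam = (2 * Real.exp 3) ^ lam * r ^ lam := by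
      rw [← mul_assoc, Real.mul_rpow (by positivity) (by linarith)]
    have h6 : r ^ a = r ^ (a - lam) * r ^ lam := by
      rw [← Real.rpow_add (by linarith)]; simp
    have h7 : (nCount A (Real.exp 3 * r) : ℝ) * Real.log 2 ≤ r ^ a * Real.log 2 := by
      calc _ ≤ _ := h4
        _ ≤ _ := h1
        _ = (2 * Real.exp 3) ^ lam * r ^ lam := h5
        _ ≤ (r ^ (a - lam) * Real.log 2) * r ^ lam := by gcongr
        _ = _ := by rw [h6]; ring
    exact le_of_mul_le_mul_right h7 hlog2
  have hE2 : ∀ᶠ r : ℝ in atTop, x0 ≤ r ^ b / (Real.log r + 2) ^ 2 ∧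
      r ^ b' ≤ r ^ b / (Real.log r + 2) ^ 2 := by
    filter_upwards [log_pow_le 2 (c := b - b') (ε := 1 / 9) (by linarith) (by norm_num),
      (tendsto_rpow_atTop hb'0).eventually_ge_atTop x0, eventually_ge_atTop 3] with r h1 h2 h3
    have hr0 : 0 < r := by linarith
    have hl1 : 1 ≤ Real.log r := by
      rw [Real.le_log_iff_exp_le hr0]; linarith [Real.exp_one_lt_d9]
    have h4 : r ^ b' ≤ r ^ b / (Real.log r + 2) ^ 2 := by
      rw [le_div_iff₀ (by positivity)]
      have h5 : r ^ b = r ^ b' * r ^ (b - b') := by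
        rw [← Real.rpow_add hr0]; simp
      rw [h5]
      gcongr
      nlinarith
    exact ⟨h2.trans h4, h4⟩
  obtain ⟨r, hTr, hr1, hr2, hr3, hr4, hr5, hr6, hr7, hr8⟩ := (hT.and_eventually (hE1.and (hE2.and
    (hN.and ((log_pow_le 1 (c := μ - a) (ε := 1 / 100) (by linarith) (by norm_num)).and
    ((log_pow_le 0 (c := μ - b) (ε := 1 / 100) (by linarith) (by norm_num)).and
    (((tendsto_rpow_atTop (hlam.trans hlm)).eventually_ge_atTop (100 * Real.log M)).and
    ((eventually_ge_atTop 3).and (eventually_ge_atTop L))))))))).exists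
  set n := nCount A (Real.exp 3 * r) with hn
  have hr0 : 0 < r := by linarith
  have hl1 : 1 ≤ Real.log r := by
    rw [Real.le_log_iff_exp_le hr0]; linarith [Real.exp_one_lt_d9]
  have hrμ0 : 0 < r ^ μ := by positivity
  have q1 : r ^ a * Real.log r ≤ 1 / 100 * r ^ μ := by
    have : r ^ μ = r ^ a * r ^ (μ - a) := by rw [← Real.rpow_add hr0]; simp
    rw [this]
    rw [pow_one] at hr4
    have : r ^ a * Real.log r ≤ r ^ a * (1 / 100 * r ^ (μ - a)) := by gcongr
    linarith
  have q2 : r ^ b ≤ 1 / 100 * r ^ μ := by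
    have : r ^ μ = r ^ b * r ^ (μ - b) := by rw [← Real.rpow_add hr0]; simp
    rw [this]
    rw [pow_zero] at hr5
    have : r ^ b * 1 ≤ r ^ b * (1 / 100 * r ^ (μ - b)) := by gcongr
    linarith
  have q3 : r ^ lam ≤ r ^ b := Real.rpow_le_rpow_of_exponent_le (by linarith) (by linarith)
  have q4 : r ^ a ≤ r ^ b := Real.rpow_le_rpow_of_exponent_le (by linarith) (by linarith)
  have q5 : (n:ℝ) * Real.log r ≤ 1 / 100 * r ^ μ := le_trans (by gcongr) q1
  have hlog23 : Real.log 23 ≤ 4 := by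
    rw [Real.log_le_iff_le_exp (by norm_num)]
    have h1 := Real.exp_one_gt_d9
    have h2 : Real.exp 4 = Real.exp 1 ^ 4 := by rw [← Real.exp_nat_mul]; norm_num
    rw [h2]
    calc (23:ℝ) ≤ 2.7 ^ 4 := by norm_num
      _ ≤ _ := by gcongr; linarith
  have hn0 : (0:ℝ) ≤ n := Nat.cast_nonneg n
  have hlog2' : Real.log 2 ≤ 1 := by linarith [Real.log_two_lt_d9]
  have hlogρ : Real.log (2 * Real.exp 3 * r) ≤ 5 * Real.log r := by
    rw [Real.log_mul (by positivity) hr0.ne', Real.log_mul (by norm_num) (by positivity),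
      Real.log_exp]
    linarith
  have hpow : (2 * Real.exp 3 * r) ^ n = Real.exp (n * Real.log (2 * Real.exp 3 * r)) := by
    rw [Real.exp_nat_mul, Real.exp_log (by positivity)]
  have hnlog : n * Real.log (2 * Real.exp 3 * r) ≤ 5 / 100 * r ^ μ := by
    have : (n:ℝ) * Real.log (2 * Real.exp 3 * r) ≤ n * (5 * Real.log r) := by gcongr
    linarith
  have he : 1 ≤ Real.exp 3 := Real.one_le_exp (by norm_num)
  obtain ⟨z, y, N, hLz, hy0, hy, hNy, hAz, happ⟩ := scale_conc hA (r := r) (B := r ^ μ / 4)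
    (C := r ^ b) (L := L) (M := M) (n := n) (by linarith) hr8 rfl (by positivity) (by positivity)
    hLM hM (by
      have h1 : (n:ℝ) * Real.log 23 ≤ n * 4 := by gcongr
      rw [nevT] at hTr
      linarith) (by
      calc M * (L + Real.exp 3 * r) ^ n ≤ M * (2 * Real.exp 3 * r) ^ n := by
            have h0 : L + Real.exp 3 * r ≤ 2 * Real.exp 3 * r := by nlinarith
            have h1 : 0 ≤ L + Real.exp 3 * r := by nlinarith
            gcongr
        _ = Real.exp (Real.log M + n * Real.log (2 * Real.exp 3 * r)) := by
            rw [hpow, Real.exp_add, Real.exp_log hM]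
        _ < _ := Real.exp_lt_exp.2 (by linarith)) (by
      rw [hpow]
      exact Real.exp_le_exp.2 (by linarith))
  have hC1 : 1 ≤ r ^ b := Real.one_le_rpow (by linarith) (by linarith)
  have hNge : r ^ b / (Real.log r + 2) ^ 2 ≤ N := by
    rw [hNy]; gcongr
  obtain ⟨⟨hN3, hNR, hN64, hN4, hN2, hNn⟩, hNk⟩ := hx0 N (hr2.1.trans hNge)
  have hN0 : 0 < N := by linarith
  have hnN : (n:ℝ) ≤ N ^ (a / b') := by
    calc (n:ℝ) ≤ r ^ a := hr1
      _ = (r ^ b') ^ (a / b') := by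
        rw [← Real.rpow_mul hr0.le]; congr 1; field_simp
      _ ≤ N ^ (a / b') := Real.rpow_le_rpow (by positivity) (hr2.2.trans hNge) (by positivity)
  have hCy : r ^ b = N * y ^ 2 := by rw [hNy]; field_simp
  have hyN : 1 ≤ √N * y := by
    have h1 : 1 ≤ (√N * y) ^ 2 := by rw [mul_pow, Real.sq_sqrt hN0.le, ← hCy]; exact hC1
    have h2 : 0 ≤ √N * y := by positivity
    exact (one_le_sq_iff₀ h2).1 h1
  have hsN : 0 < √N := Real.sqrt_pos.2 hN0
  have hsN2 : √N * √N = N := Real.mul_self_sqrt hN0.le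
  have hlN : 1 ≤ Real.log N := by
    rw [Real.le_log_iff_exp_le hN0]; linarith [Real.exp_one_lt_d9]
  have hlN0 : 0 < Real.log N := by linarith
  have hCy2 : √N ≤ r ^ b / y := by
    rw [hCy, le_div_iff₀ hy0]
    calc √N * y = (√N * y) * 1 := by ring
      _ ≤ (√N * y) * (√N * y) := by gcongr
      _ = (√N * √N) * y ^ 2 := by ring
      _ = N * y ^ 2 := by rw [hsN2]
  refine ⟨z, N, by linarith, hNk, hN3, ?_, ?_⟩
  · have h1 : √N ≤ Real.log (max 1 ‖A z‖) := by
      refine hCy2.trans ?_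
      rw [Real.le_log_iff_exp_le (by positivity)]
      exact hAz.trans (le_max_right _ _)
    rw [div_le_iff₀ (hsN.trans_le h1)]
    calc Real.log N ^ 2 ≤ δ * √N := hN2
      _ ≤ 1 / (k + 1) * Real.log (max 1 ‖A z‖) := by
        gcongr
        linarith
  · intro τ h1 h2
    set R := 32 * Real.log N ^ 2 / N with hR
    have hR0 : 0 < R := by positivity
    have hτ : ‖τ‖ ≤ R / 2 := by
      have h3 := Complex.norm_le_abs_re_add_abs_im τ
      have h4 : R / 2 = 8 * Real.log N ^ 2 / N + 8 * Real.log N ^ 2 / N := by rw [hR]; ring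
      linarith
    have hRs : R = 32 * Real.log N ^ 2 / (√N * √N) := by rw [hR, hsN2]
    refine (happ δ R hδ0 hδ4 hR0 hNR ?_ ?_ (hNn n hnN) τ hτ).trans ?_
    · rw [hR, div_le_iff₀ hN0]
      have : √N * 1 ≤ √N * (√N * y) := by gcongr
      have h5 : √N * (√N * y) = N * y := by rw [← mul_assoc, hsN2]
      linarith
    · have h5 : 2 * N * R ^ 2 = 2048 * Real.log N ^ 4 / N := by rw [hR]; field_simp; ring
      rw [h5, div_le_iff₀ hy0, div_le_iff₀ hN0]
      have : √N * 1 ≤ √N * (√N * y) := by gcongr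
      have h6 : √N * (√N * y) = N * y := by rw [← mul_assoc, hsN2]
      have h7 : δ * √N ≤ δ * (N * y) := by gcongr; linarith
      linarith
    · gcongr

lemma limsup_N_nonneg {A : ℂ → ℂ} {P : Set ℂ} (hA : MeroPlane A P) :
    (0 : EReal) ≤
      Filter.limsup (fun r : ℝ => ((Real.log (nevN A r) / Real.log r : ℝ) : EReal)) atTop := by
  by_cases h : ∃ t0, 1 ≤ nCount A t0
  · obtain ⟨t0, ht0⟩ := h
    have h1 : Tendsto (fun r : ℝ => ((Real.log (Real.log 2) / Real.log r : ℝ) : EReal)) atTop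
        (𝓝 ((0:ℝ) : EReal)) :=
      (continuous_coe_real_ereal.tendsto 0).comp (Real.tendsto_log_atTop.const_div_atTop _)
    have h2 := h1.limsup_eq
    rw [show (0:EReal) = ((0:ℝ):EReal) from rfl, ← h2]
    refine Filter.limsup_le_limsup ?_
    filter_upwards [eventually_ge_atTop (2 * max t0 1), eventually_ge_atTop 2] with r hr hr2
    have h3 : max t0 1 ≤ r / 2 := by linarith
    have h4 := nevN_lower hA (t := r / 2) ((le_max_right _ _).trans h3)
    rw [mul_div_cancel₀ r (by norm_num : (2:ℝ) ≠ 0)] at h4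
    have h5 : 1 ≤ nCount A (r / 2) := ht0.trans (nCount_mono hA ((le_max_left _ _).trans h3))
    have h6 : (1:ℝ) ≤ nCount A (r / 2) := by exact_mod_cast h5
    have hl2 : 0 < Real.log 2 := Real.log_pos (by norm_num)
    have h7 : Real.log 2 ≤ nevN A r := by nlinarith
    have h8 : 0 < Real.log r := Real.log_pos (by linarith)
    rw [EReal.coe_le_coe_iff]
    gcongr
  · push Not at h
    have h0 : ∀ t, nCount A t = 0 := fun t => by have := h t; omega
    have h1 : ∀ r, nevN A r = 0 := fun r => by simp [nevN, h0]
    simp [h1]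

lemma nevm_nonneg (A : ℂ → ℂ) (r : ℝ) : 0 ≤ nevm A r := by
  rw [nevm]
  refine mul_nonneg (by positivity) ?_
  refine intervalIntegral.integral_nonneg (by positivity) fun θ _ => ?_
  exact Real.log_nonneg (le_max_left _ _)

lemma main_all {A : ℂ → ℂ} {P : Set ℂ} (hA : MeroPlane A P) (hB : BorelExceptionalInfty A) (k : ℕ) :
    ∃ (z : ℂ) (N : ℝ), k < ‖z‖ ∧ k ≤ N ∧ 3 ≤ N ∧
      Real.log N ^ 2 / Real.log (max 1 ‖A z‖) ≤ 1 / (k + 1) ∧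
      ∀ τ : ℂ, |τ.re| ≤ 8 * Real.log N ^ 2 / N → |τ.im| ≤ 8 * Real.log N ^ 2 / N →
        ‖A (z * Complex.exp τ) - Complex.exp (N * τ) * A z‖ ≤
          1 / (k + 1) * ‖Complex.exp (N * τ) * A z‖ := by
  have h0 := limsup_N_nonneg hA
  obtain ⟨lam, hl1, hl2⟩ := EReal.lt_iff_exists_real_btwn.1 hB
  obtain ⟨μ, hm1, hm2⟩ := EReal.lt_iff_exists_real_btwn.1 hl2
  have hlam : 0 < lam := by exact_mod_cast h0.trans_lt hl1
  have hlm : lam < μ := by exact_mod_cast hm1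
  refine main_scale hA hlam hlm ?_ ?_ k
  · filter_upwards [eventually_lt_of_limsup_lt hl1, eventually_ge_atTop 2] with r h1 h2
    rw [EReal.coe_lt_coe_iff] at h1
    have hlr : 0 < Real.log r := Real.log_pos (by linarith)
    rw [div_lt_iff₀ hlr] at h1
    rcases le_or_gt (nevN A r) 0 with h3 | h3
    · exact h3.trans (by positivity)
    · rw [Real.rpow_def_of_pos (by linarith), ← Real.log_le_iff_le_exp h3]
      linarith
  · refine ((frequently_lt_of_lt_limsup (by isBoundedDefault) hm2).and_eventually
      (eventually_ge_atTop (2:ℝ))).mono ?_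
    rintro r ⟨h1, h2⟩
    rw [EReal.coe_lt_coe_iff] at h1
    have hlr : 0 < Real.log r := Real.log_pos (by linarith)
    rw [lt_div_iff₀ hlr] at h1
    have hT0 : 0 ≤ nevT A r := add_nonneg (nevm_nonneg A r) (nevN_nonneg hA h2)
    have hT1 : 0 < nevT A r := by
      rcases hT0.eq_or_lt with h | h
      · rw [← h, Real.log_zero] at h1
        have : 0 < μ * Real.log r := mul_pos (hlam.trans hlm) hlr
        linarith
      · exact h
    rw [Real.rpow_def_of_pos (by linarith), ← Real.lt_log_iff_exp_lt hT1]
    linarith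

/-- Lemma 7.3: a transcendental meromorphic function in the plane for which
∞ is a Borel exceptional value has the Wiman-Valiron property. -/
theorem wiman_valiron_of_borel_exceptional
    (A : ℂ → ℂ) (PA : Set ℂ)
    (hA : TranscMeroPlane A PA)
    (hB : BorelExceptionalInfty A) :
    HasWVProp A 0 := by
  choose Z Nk hZ hNk hN3 hsm happ using main_all hA.1 hB
  set F1 : Set ℝ := Set.range fun k => ‖Z k‖ with hF1
  have hex : ∀ r : ℝ, ∃ k : ℕ, r ∈ F1 → ‖Z k‖ = r := by
    intro r
    by_cases h : r ∈ F1
    · obtain ⟨k, hk⟩ := h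
      exact ⟨k, fun _ => hk⟩
    · exact ⟨0, fun h' => absurd h' h⟩
  choose κ hκ using hex
  have hκt : Tendsto κ (atTop ⊓ 𝓟 F1) atTop := by
    rw [tendsto_atTop]
    intro k0
    rw [eventually_inf_principal]
    filter_upwards [eventually_gt_atTop (∑ j ∈ Finset.range k0, ‖Z j‖)] with r hr hrF
    by_contra! hcon
    have h1 : ‖Z (κ r)‖ ≤ ∑ j ∈ Finset.range k0, ‖Z j‖ :=
      Finset.single_le_sum (f := fun j => ‖Z j‖) (fun _ _ => norm_nonneg _)
        (Finset.mem_range.2 hcon)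
    rw [hκ r hrF] at h1
    linarith
  have hlog : ∀ k, 1 ≤ Real.log (Nk k) := fun k => by
    rw [Real.le_log_iff_exp_le (by linarith [hN3 k])]
    linarith [Real.exp_one_lt_d9, hN3 k]
  have hNt : Tendsto (fun r => Nk (κ r)) (atTop ⊓ 𝓟 F1) atTop :=
    (tendsto_atTop_mono hNk tendsto_natCast_atTop_atTop).comp hκt
  have hk1 : Tendsto (fun r => 1 / ((κ r : ℝ) + 1)) (atTop ⊓ 𝓟 F1) (𝓝 0) :=
    tendsto_one_div_add_atTop_nhds_zero_nat.comp hκt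
  refine ⟨{ F1 := F1, N := fun r => Nk (κ r), phi := fun r => Real.log (Nk (κ r)) ^ 2,
            zr := fun r => Z (κ r), F1_sub := ?_, F1_unbounded := ?_, N_ge := ?_, phi_ge := ?_,
            N_tendsto := hNt, phi_over_N := ?_, phi_over_logN := ?_, zr_abs := ?_,
            phi_small := ?_, approx := ?_ }⟩
  · rintro _ ⟨k, rfl⟩
    exact norm_nonneg _
  · intro c
    obtain ⟨k, hk⟩ := exists_nat_gt c
    exact ⟨‖Z k‖, ⟨k, rfl⟩, hk.trans (hZ k)⟩
  · intro r _
    linarith [hN3 (κ r)]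
  · intro r _
    exact one_le_pow₀ (hlog _)
  · have h1 : Tendsto (fun x : ℝ => Real.log x ^ 2 / x) atTop (𝓝 0) := by
      simpa using log_pow_div 2 (c := 1) one_pos
    exact h1.comp hNt
  · refine (Real.tendsto_log_atTop.comp hNt).congr fun r => ?_
    have := hlog (κ r)
    simp only [Function.comp]
    field_simp
  · intro r hr
    exact hκ r hr
  · refine squeeze_zero (fun r => ?_) (fun r => hsm (κ r)) hk1
    exact div_nonneg (sq_nonneg _) (Real.log_nonneg (le_max_left _ _))
  · intro ε hε
    filter_upwards [hk1.eventually (gt_mem_nhds hε)] with r hr τ h1 h2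
    refine (happ (κ r) τ h1 h2).trans ?_
    gcongr

end
end

section
/- Let A be meromorphic in R ≤ |z| < ∞ with an essential singularity at infinity and suppose A has the Wiman-Valiron property with data F₁, N, φ, z_r, and let Z and Z_r be as defined. Then there exists r₀ such that for all r ∈ F₁ with r ≥ r₀ and all z ∈ D(z_r, 3) with Z(z) ∈ J₁ = { Z : |log|Z/Z_r|| ≤ φ(r), |arg Z| ≤ π/4 }: |A''(z)/(4A(z)²) − 5A'(z)²/(16A(z)³)| ≤ 3|Z(z)|^{−2}. -/
open Filter Set Topology Bornology MeasureTheory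

noncomputable section

def sq4 (ρ : ℝ) : Set ℂ := {τ | |τ.re| ≤ 4*ρ ∧ |τ.im| ≤ 4*ρ}

lemma sq4_convex (ρ : ℝ) : Convex ℝ (sq4 ρ) := by
  intro x hx y hy a b ha hb hab
  simp only [sq4, mem_ofPred_eq, abs_le] at *
  obtain ⟨⟨h1,h2⟩,h3,h4⟩ := hx
  obtain ⟨⟨g1,g2⟩,g3,g4⟩ := hy
  have hb' : b = 1 - a := by linarith
  subst hb'
  simp
  refine ⟨⟨?_, ?_⟩, ?_, ?_⟩ <;> nlinarith

lemma sqrt_near_one (ρ ε : ℝ) (hρ : 0 < ρ) (hε : ε < 1) (k : ℂ → ℂ)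
    (hk : ∀ τ ∈ sq4 ρ, AnalyticAt ℂ k τ) (hk0 : k 0 = 1)
    (h : ∀ τ ∈ sq4 ρ, ‖k τ ^ 2 - 1‖ ≤ ε) : ∀ τ ∈ sq4 ρ, ‖k τ - 1‖ ≤ ε := by
  intro τ hτ
  have h0 : (0:ℂ) ∈ sq4 ρ := by simp [sq4]; positivity
  have hne : ∀ t ∈ sq4 ρ, (k t).re ≠ 0 := by
    intro t ht h0
    have h1 := h t ht
    have h2 := Complex.abs_re_le_norm (k t ^ 2 - 1)
    have h3 : (k t ^ 2 - 1).re = - (k t).im ^ 2 - 1 := by simp [pow_two, h0]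
    rw [h3] at h2
    have := neg_le_abs (- (k t).im ^ 2 - 1)
    nlinarith [sq_nonneg (k t).im]
  have hcont : ContinuousOn (fun t => (k t).re) (sq4 ρ) := fun t ht =>
    (Complex.continuous_re.continuousAt.comp (hk t ht).continuousAt).continuousWithinAt
  have hpos : 0 < (k τ).re := by
    by_contra hcon
    push Not at hcon
    have := (sq4_convex ρ).isPreconnected.intermediate_value hτ h0 hcont
    obtain ⟨t, ht, ht'⟩ := this (show (0:ℝ) ∈ Icc _ _ from ⟨hcon, by simp [hk0]⟩)
    exact hne t ht ht'
  have h1 := h τ hτ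
  have : k τ ^ 2 - 1 = (k τ - 1) * (k τ + 1) := by ring
  rw [this, norm_mul] at h1
  have h2 := Complex.abs_re_le_norm (k τ + 1)
  have h3 : (1:ℝ) ≤ ‖k τ + 1‖ := by
    refine le_trans ?_ h2
    rw [Complex.add_re, Complex.one_re]
    exact le_trans (by linarith) (le_abs_self _)
  nlinarith [norm_nonneg (k τ - 1)]

lemma sub3 (ρ : ℝ) (τ : ℂ) (h1 : |τ.re| ≤ 3*ρ) (h2 : |τ.im| ≤ 3*ρ) :
    Metric.closedBall τ ρ ⊆ sq4 ρ := by
  intro w hw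
  rw [Metric.mem_closedBall, dist_eq_norm] at hw
  have a1 := (Complex.abs_re_le_norm (w-τ)).trans hw
  have a2 := (Complex.abs_im_le_norm (w-τ)).trans hw
  simp only [sq4, mem_ofPred_eq, Complex.sub_re, Complex.sub_im, abs_le] at *
  refine ⟨⟨?_, ?_⟩, ?_, ?_⟩ <;> linarith

lemma cauchy_k (ρ ε : ℝ) (hρ : 0 < ρ) (k : ℂ → ℂ)
    (hk : ∀ τ ∈ sq4 ρ, AnalyticAt ℂ k τ)
    (h : ∀ τ ∈ sq4 ρ, ‖k τ - 1‖ ≤ ε) (τ : ℂ) (h1 : |τ.re| ≤ 3*ρ) (h2 : |τ.im| ≤ 3*ρ) :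
    ‖deriv k τ‖ ≤ ε / ρ ∧ ‖deriv (deriv k) τ‖ ≤ 2 * ε / ρ ^ 2 := by
  have hsub := sub3 ρ τ h1 h2
  have hd : DiffContOnCl ℂ (fun t => k t - 1) (Metric.ball τ ρ) := by
    apply DifferentiableOn.diffContOnCl
    rw [closure_ball _ hρ.ne']
    intro t ht
    exact ((hk t (hsub ht)).differentiableAt.sub_const 1).differentiableWithinAt
  have hb : ∀ z ∈ Metric.sphere τ ρ, ‖k z - 1‖ ≤ ε := fun z hz =>
    h z (hsub (Metric.sphere_subset_closedBall hz))
  have e1 : deriv (fun t => k t - 1) = deriv k := by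
    funext t; simp
  constructor
  · have := Complex.norm_deriv_le_of_forall_mem_sphere_norm_le hρ hd hb
    rwa [e1] at this
  · have := Complex.norm_iteratedDeriv_le_of_forall_mem_sphere_norm_le 2 hρ hd hb
    rw [iteratedDeriv_succ, iteratedDeriv_one, e1] at this
    simpa using this

lemma V_near (ρ ε M : ℝ) (hρ : 0 < ρ) (hM : 0 < M) (hε : 0 ≤ ε) (C : ℂ) (k V : ℂ → ℂ)
    (hV : ∀ τ ∈ sq4 ρ, HasDerivAt V (C * k τ * Complex.exp (M * τ)) τ)
    (hV0 : V (-(4*ρ) : ℝ) = C / M * k (-(4*ρ) : ℝ) * Complex.exp (M * (-(4*ρ) : ℝ)))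
    (h : ∀ τ ∈ sq4 ρ, ‖k τ - 1‖ ≤ ε) (τ : ℂ) (h1 : |τ.re| ≤ 3*ρ) (h2 : |τ.im| ≤ 3*ρ) :
    ‖V τ - C / M * Complex.exp (M * τ)‖ ≤ 5 * ε * ‖C / M * Complex.exp (M * τ)‖ := by
  set τ0 : ℂ := ((-(4*ρ) : ℝ) : ℂ) with hτ0
  have hM' : (M:ℂ) ≠ 0 := by exact_mod_cast hM.ne'
  have hτ : τ ∈ sq4 ρ := sub3 ρ τ h1 h2 (Metric.mem_closedBall_self hρ.le)
  have hτ0m : τ0 ∈ sq4 ρ := by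
    simp [hτ0, sq4, abs_of_pos hρ]; positivity
  set p : ℝ → ℂ := fun t => τ0 + t * (τ - τ0) with hp
  have hpd : ∀ t, HasDerivAt p (τ - τ0) t := by
    intro t
    have := ((Complex.ofRealCLM.hasDerivAt (x := t)).mul_const (τ - τ0)).const_add τ0
    simpa [hp] using this
  have hpm : ∀ t ∈ Icc (0:ℝ) 1, p t ∈ sq4 ρ := by
    intro t ht
    have := (sq4_convex ρ) hτ0m hτ (sub_nonneg.2 ht.2) ht.1 (by ring)
    convert this using 1
    simp [hp]; ring
  have hpre : ∀ t, (p t).re = -(4*ρ) + t * (τ.re + 4*ρ) := by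
    intro t; simp [hp, hτ0]
  set G : ℂ → ℂ := fun τ => V τ - C / M * Complex.exp (M * τ) with hG
  have hGd : ∀ t ∈ sq4 ρ, HasDerivAt G (C * (k t - 1) * Complex.exp (M * t)) t := by
    intro t ht
    have e1 : HasDerivAt (fun t : ℂ => Complex.exp (M * t)) (Complex.exp (M*t) * (M * 1)) t :=
      ((hasDerivAt_id t).const_mul (M:ℂ)).cexp
    have := (hV t ht).sub (e1.const_mul (C / M))
    have e2 : C * (k t - 1) * Complex.exp (M * t)
        = C * k t * Complex.exp (M * t) - C / M * (Complex.exp (M*t) * (M * 1)) := by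
      field_simp
    rw [e2]
    exact this
  have hnorm : ∀ t : ℝ, ‖Complex.exp (M * p t)‖ = Real.exp (M * (-(4*ρ) + t * (τ.re + 4*ρ))) := by
    intro t; rw [Complex.norm_exp, ← hpre]; simp
  have hrpos : ρ ≤ τ.re + 4*ρ := by linarith [(abs_le.1 h1).1]
  have hlen : ‖τ - τ0‖ ≤ 4 * (τ.re + 4*ρ) := by
    have := Complex.norm_le_abs_re_add_abs_im (τ - τ0)
    have e1 : (τ - τ0).re = τ.re + 4*ρ := by simp [hτ0]
    have e2 : (τ - τ0).im = τ.im := by simp [hτ0]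
    rw [e1, e2, abs_of_nonneg (by linarith)] at this
    linarith
  set B : ℝ → ℝ := fun t => 5 * ε * ‖C‖ / M * Real.exp (M * (-(4*ρ) + t * (τ.re + 4*ρ))) with hB
  have hBd : ∀ t, HasDerivAt B (5 * ε * ‖C‖ / M * (Real.exp (M * (-(4*ρ) + t * (τ.re + 4*ρ))) * (M * (τ.re + 4*ρ)))) t := by
    intro t
    have : HasDerivAt (fun t : ℝ => M * (-(4*ρ) + t * (τ.re + 4*ρ))) (M * (τ.re + 4*ρ)) t := by
      simpa using (((hasDerivAt_id t).mul_const (τ.re + 4*ρ)).const_add (-(4*ρ))).const_mul M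
    exact this.exp.const_mul _
  have hcomp : ∀ t ∈ Icc (0:ℝ) 1, HasDerivAt (fun t => G (p t)) (C * (k (p t) - 1) * Complex.exp (M * p t) * (τ - τ0)) t :=
    fun t ht => (hGd _ (hpm t ht)).comp t (hpd t)
  have key := image_norm_le_of_norm_deriv_right_le_deriv_boundary (a := 0) (b := 1)
    (f := fun t => G (p t)) (f' := fun t => C * (k (p t) - 1) * Complex.exp (M * p t) * (τ - τ0))
    (B := B) (B' := fun t => 5 * ε * ‖C‖ / M * (Real.exp (M * (-(4*ρ) + t * (τ.re + 4*ρ))) * (M * (τ.re + 4*ρ))))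
    (fun t ht => (hcomp t ht).continuousAt.continuousWithinAt)
    (fun t ht => (hcomp t (Ico_subset_Icc_self ht)).hasDerivWithinAt)
    (by
      have e : G (p 0) = C / M * (k τ0 - 1) * Complex.exp (M * τ0) := by
        simp only [hp, hG, Complex.ofReal_zero, zero_mul, add_zero]
        rw [hV0]; ring
      have hn := hnorm 0
      have ep : p 0 = τ0 := by simp [hp]
      rw [ep] at hn
      show ‖G (p 0)‖ ≤ B 0
      rw [e, norm_mul, norm_mul, hn, norm_div, Complex.norm_of_nonneg hM.le]
      simp only [hB]
      gcongr
      have := h τ0 hτ0m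
      calc ‖C‖ / M * ‖k τ0 - 1‖ ≤ ‖C‖ / M * (5*ε) := by gcongr; linarith
        _ = _ := by ring)
    (fun t => hBd t)
    (by
      intro t ht
      have hk := h (p t) (hpm t (Ico_subset_Icc_self ht))
      show ‖C * (k (p t) - 1) * Complex.exp (M * p t) * (τ - τ0)‖ ≤ 5 * ε * ‖C‖ / M * (Real.exp (M * (-(4*ρ) + t * (τ.re + 4*ρ))) * (M * (τ.re + 4*ρ)))
      rw [norm_mul, norm_mul, norm_mul, hnorm]
      set E := Real.exp (M * (-(4*ρ) + t * (τ.re + 4*ρ)))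
      have hE : 0 < E := Real.exp_pos _
      calc ‖C‖ * ‖k (p t) - 1‖ * E * ‖τ - τ0‖ ≤ ‖C‖ * ε * E * (5 * (τ.re + 4*ρ)) := by
            gcongr; linarith
        _ = _ := by field_simp)
  have k1 := key (right_mem_Icc.2 zero_le_one)
  have ep : p 1 = τ := by simp [hp]
  have hn := hnorm 1
  rw [ep] at k1 hn
  refine k1.trans (le_of_eq ?_)
  rw [norm_mul, hn, norm_div, Complex.norm_of_nonneg hM.le]
  simp only [hB]; ring

lemma nhds_sq4 (ρ : ℝ) (hρ : 0 < ρ) (τ : ℂ) (h1 : |τ.re| ≤ 3*ρ) (h2 : |τ.im| ≤ 3*ρ) :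
    sq4 ρ ∈ 𝓝 τ :=
  Filter.mem_of_superset (Metric.closedBall_mem_nhds τ hρ) (sub3 ρ τ h1 h2)

lemma hasDeriv_aexp (a τ : ℂ) :
    HasDerivAt (fun t => a * Complex.exp t) (a * Complex.exp τ) τ :=
  (Complex.hasDerivAt_exp τ).const_mul a

lemma k_derivs (N a s0 τ : ℂ) (s : ℂ → ℂ) (hs : AnalyticAt ℂ s (a * Complex.exp τ)) :
    deriv (fun t => s (a * Complex.exp t) * Complex.exp (-(N/2) * t) / s0) τ
      = (deriv s (a * Complex.exp τ) * (a * Complex.exp τ) - N / 2 * s (a * Complex.exp τ))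
        * Complex.exp (-(N/2) * τ) / s0 ∧
    deriv (deriv (fun t => s (a * Complex.exp t) * Complex.exp (-(N/2) * t) / s0)) τ
      = (deriv (deriv s) (a * Complex.exp τ) * (a * Complex.exp τ) ^ 2
        + deriv s (a * Complex.exp τ) * (a * Complex.exp τ)
        - N * deriv s (a * Complex.exp τ) * (a * Complex.exp τ)
        + N ^ 2 / 4 * s (a * Complex.exp τ))
        * Complex.exp (-(N/2) * τ) / s0 := by
  have hE : ∀ t : ℂ, HasDerivAt (fun t => Complex.exp (-(N/2) * t))
      (Complex.exp (-(N/2) * t) * (-(N/2) * 1)) t := fun t =>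
    ((hasDerivAt_id t).const_mul (-(N/2))).cexp
  have hd : ∀ t : ℂ, AnalyticAt ℂ s (a * Complex.exp t) →
      HasDerivAt (fun t => s (a * Complex.exp t) * Complex.exp (-(N/2) * t) / s0)
      ((deriv s (a * Complex.exp t) * (a * Complex.exp t) - N / 2 * s (a * Complex.exp t))
        * Complex.exp (-(N/2) * t) / s0) t := by
    intro t ht
    have h1 := (ht.differentiableAt.hasDerivAt).comp t (hasDeriv_aexp a t)
    have h2 := (h1.mul (hE t)).div_const s0
    refine HasDerivAt.congr_deriv h2 ?_
    simp only [Function.comp]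
    ring
  refine ⟨(hd τ hs).deriv, ?_⟩
  have hev : ∀ᶠ t in 𝓝 τ, AnalyticAt ℂ s (a * Complex.exp t) :=
    (hasDeriv_aexp a τ).continuousAt.eventually hs.eventually_analyticAt
  have heq : deriv (fun t => s (a * Complex.exp t) * Complex.exp (-(N/2) * t) / s0) =ᶠ[𝓝 τ]
      fun t => (deriv s (a * Complex.exp t) * (a * Complex.exp t) - N / 2 * s (a * Complex.exp t))
        * Complex.exp (-(N/2) * t) / s0 := hev.mono fun t ht => (hd t ht).deriv
  rw [heq.deriv_eq]
  have h1 := (hs.differentiableAt.hasDerivAt).comp τ (hasDeriv_aexp a τ)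
  have h2 := (hs.deriv.differentiableAt.hasDerivAt).comp τ (hasDeriv_aexp a τ)
  have h3 := (((h2.mul (hasDeriv_aexp a τ)).sub (h1.const_mul (N/2))).mul (hE τ)).div_const s0
  refine Eq.trans h3.deriv ?_
  simp only [Function.comp, Pi.mul_apply, Pi.sub_apply]
  ring

lemma A_derivs (A s : ℂ → ℂ) (z : ℂ) (hs : AnalyticAt ℂ s z)
    (h : ∀ᶠ w in 𝓝 z, s w ^ 2 = A w) :
    deriv A z = 2 * s z * deriv s z ∧
    deriv (deriv A) z = 2 * deriv s z ^ 2 + 2 * s z * deriv (deriv s) z := by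
  have h' : A =ᶠ[𝓝 z] fun w => s w ^ 2 := h.mono fun w hw => hw.symm
  have hd : deriv A =ᶠ[𝓝 z] fun w => 2 * s w * deriv s w := by
    refine h'.deriv.trans ?_
    filter_upwards [hs.eventually_analyticAt] with w hw
    have := (hw.differentiableAt.hasDerivAt.pow 2).deriv
    refine Eq.trans this ?_
    simp
  refine ⟨hd.self_of_nhds, ?_⟩
  rw [hd.deriv_eq]
  have := ((hs.differentiableAt.hasDerivAt.const_mul 2).mul hs.deriv.differentiableAt.hasDerivAt).deriv
  refine Eq.trans this ?_
  ring

lemma alg_bound (N : ℝ) (hN : 2 ≤ N) (p q : ℂ) (hp : ‖p‖ ≤ N / 50) (hq : ‖q‖ ≤ N ^ 2 / 25) :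
    ‖q / 2 - p * ((N:ℂ) / 4 + 1 / 2) - ((N:ℂ) ^ 2 / 16 + N / 4) - 3 / 4 * p ^ 2‖ ≤ N ^ 2 / 4 := by
  have e1 : ‖((N:ℂ) / 4 + 1 / 2)‖ = N / 4 + 1 / 2 := by
    rw [show ((N:ℂ) / 4 + 1 / 2) = ((N / 4 + 1 / 2 : ℝ) : ℂ) by push_cast; ring]
    exact Complex.norm_of_nonneg (by linarith)
  have e2 : ‖((N:ℂ) ^ 2 / 16 + N / 4)‖ = N ^ 2 / 16 + N / 4 := by
    rw [show ((N:ℂ) ^ 2 / 16 + N / 4) = ((N ^ 2 / 16 + N / 4 : ℝ) : ℂ) by push_cast; ring]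
    exact Complex.norm_of_nonneg (by positivity)
  have n1 := norm_sub_le (q / 2 - p * ((N:ℂ) / 4 + 1 / 2) - ((N:ℂ) ^ 2 / 16 + N / 4)) (3 / 4 * p ^ 2)
  have n2 := norm_sub_le (q / 2 - p * ((N:ℂ) / 4 + 1 / 2)) ((N:ℂ) ^ 2 / 16 + N / 4)
  have n3 := norm_sub_le (q / 2) (p * ((N:ℂ) / 4 + 1 / 2))
  have m1 : ‖q / 2‖ = ‖q‖ / 2 := by simp
  have m2 : ‖3 / 4 * p ^ 2‖ = 3 / 4 * ‖p‖ ^ 2 := by simp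
  have m3 : ‖p * ((N:ℂ) / 4 + 1 / 2)‖ ≤ N / 50 * (N / 4 + 1 / 2) := by
    rw [norm_mul, e1]; gcongr
  have m4 : ‖p‖ ^ 2 ≤ (N / 50) ^ 2 := by gcongr
  nlinarith

lemma core (N ρ : ℝ) (hN : 2 ≤ N) (hρ : 0 < ρ) (hρN : 1 ≤ ρ * N) (a : ℂ) (ha : a ≠ 0)
    (A s Z : ℂ → ℂ)
    (hs : ∀ τ ∈ sq4 ρ, s (a * Complex.exp τ) ^ 2 = A (a * Complex.exp τ) ∧
      AnalyticAt ℂ s (a * Complex.exp τ) ∧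
      HasDerivAt Z (s (a * Complex.exp τ)) (a * Complex.exp τ))
    (hZ0 : Z (a * Complex.exp ((-(4*ρ) : ℝ) : ℂ)) = 2 * (a * Complex.exp ((-(4*ρ) : ℝ) : ℂ))
      * s (a * Complex.exp ((-(4*ρ) : ℝ) : ℂ)) / ((N:ℂ) + 2))
    (happ : ∀ τ ∈ sq4 ρ, ‖A (a * Complex.exp τ) - Complex.exp ((N : ℂ) * τ) * A a‖
        ≤ 1 / 100 * ‖Complex.exp ((N : ℂ) * τ) * A a‖)
    (hA : A a ≠ 0) (τ : ℂ) (h1 : |τ.re| ≤ 3*ρ) (h2 : |τ.im| ≤ 3*ρ)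
    (hZ : Z (a * Complex.exp τ) ≠ 0) :
    ‖deriv (deriv A) (a * Complex.exp τ) / (4 * A (a * Complex.exp τ) ^ 2)
      - 5 * (deriv A (a * Complex.exp τ)) ^ 2 / (16 * A (a * Complex.exp τ) ^ 3)‖
      ≤ 3 / ‖Z (a * Complex.exp τ)‖ ^ 2 := by
  have hτ : τ ∈ sq4 ρ := sub3 ρ τ h1 h2 (Metric.mem_closedBall_self hρ.le)
  have h0 : (0:ℂ) ∈ sq4 ρ := by simp [sq4]; positivity
  have hs0 : s a ^ 2 = A a := by simpa using (hs 0 h0).1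
  have hs0ne : s a ≠ 0 := by
    intro h; rw [h] at hs0; exact hA (by rw [← hs0]; simp)
  set k : ℂ → ℂ := fun t => s (a * Complex.exp t) * Complex.exp (-((N:ℂ)/2) * t) / s a with hk
  have hkan : ∀ t ∈ sq4 ρ, AnalyticAt ℂ k t := by
    intro t ht
    have e1 : AnalyticAt ℂ (fun t => a * Complex.exp t) t := by fun_prop
    have e2 : AnalyticAt ℂ (fun t => s (a * Complex.exp t)) t :=
      AnalyticAt.comp (f := fun t => a * Complex.exp t) (hs t ht).2.1 e1
    have e3 : AnalyticAt ℂ (fun t => Complex.exp (-((N:ℂ)/2) * t)) t := by fun_prop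
    exact (e2.mul e3).div analyticAt_const hs0ne
  have hk0 : k 0 = 1 := by simp [hk, hs0ne]
  have hksq : ∀ t ∈ sq4 ρ, ‖k t ^ 2 - 1‖ ≤ 1 / 100 := by
    intro t ht
    have e := happ t ht
    rw [← (hs t ht).1] at e
    have hne : Complex.exp (N * t) * A a ≠ 0 := mul_ne_zero (Complex.exp_ne_zero _) hA
    have e2 : k t ^ 2 - 1 = (s (a * Complex.exp t) ^ 2 - Complex.exp (N * t) * A a)
        / (Complex.exp (N * t) * A a) := by
      have e3 : Complex.exp (-((N:ℂ)/2) * t) ^ 2 = (Complex.exp (N * t))⁻¹ := by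
        rw [← Complex.exp_nat_mul, ← Complex.exp_neg]; congr 1; push_cast; ring
      simp only [hk]
      rw [div_pow, mul_pow, e3, hs0]
      have := Complex.exp_ne_zero (N * t)
      field_simp
    rw [e2, norm_div, div_le_iff₀ (norm_pos_iff.2 hne)]
    exact e
  have hk1 := sqrt_near_one ρ (1/100) hρ (by norm_num) k hkan hk0 hksq
  obtain ⟨hc1, hc2⟩ := cauchy_k ρ (1/100) hρ k hkan hk1 τ h1 h2
  have hsk : ∀ t, s (a * Complex.exp t) * (a * Complex.exp t)
      = a * s a * k t * Complex.exp (((N/2+1 : ℝ) : ℂ) * t) := by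
    intro t
    have : Complex.exp (((N/2+1 : ℝ) : ℂ) * t)
        = (Complex.exp (-((N:ℂ)/2) * t))⁻¹ * Complex.exp t := by
      rw [← Complex.exp_neg, ← Complex.exp_add]; congr 1; push_cast; ring
    rw [this]
    simp only [hk]
    have := Complex.exp_ne_zero (-((N:ℂ)/2) * t)
    field_simp
  have hN2 : (N:ℂ) + 2 ≠ 0 := by
    have : (N + 2 : ℝ) ≠ 0 := by positivity
    exact_mod_cast this
  have hV := V_near ρ (1/100) (N/2+1) hρ (by linarith) (by norm_num) (a * s a) k
    (fun t => Z (a * Complex.exp t))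
    (by
      intro t ht
      rw [← hsk]
      exact (hs t ht).2.2.comp t (hasDeriv_aexp a t))
    (by
      show Z (a * Complex.exp ((-(4*ρ) : ℝ) : ℂ)) = _
      rw [hZ0]
      have e := hsk ((-(4*ρ) : ℝ) : ℂ)
      have : (((N/2+1 : ℝ) : ℂ)) = ((N:ℂ) + 2) / 2 := by push_cast; ring
      calc _ = 2 / ((N:ℂ)+2) * (s (a * Complex.exp ((-(4*ρ) : ℝ) : ℂ)) * (a * Complex.exp ((-(4*ρ) : ℝ) : ℂ))) := by ring
        _ = _ := by
          rw [e, this]; field_simp)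
    hk1 τ h1 h2
  have hkτ := hk1 τ hτ
  have hklow : 99 / 100 ≤ ‖k τ‖ := by
    have := norm_sub_norm_le (1:ℂ) (k τ)
    rw [norm_sub_rev, norm_one] at this
    linarith
  have hkne : k τ ≠ 0 := norm_pos_iff.1 (by linarith)
  obtain ⟨d1, d2⟩ := k_derivs N a (s a) τ s (hs τ hτ).2.1
  rw [← hk] at d1 d2
  have hev : ∀ᶠ w in 𝓝 (a * Complex.exp τ), s w ^ 2 = A w := by
    have hst : HasStrictDerivAt (fun t => a * Complex.exp t) (a * Complex.exp τ) τ :=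
      (Complex.hasStrictDerivAt_exp τ).const_mul a
    have := hst.map_nhds_eq (mul_ne_zero ha (Complex.exp_ne_zero τ))
    rw [← this, Filter.eventually_map]
    filter_upwards [nhds_sq4 ρ hρ τ h1 h2] with t ht using (hs t ht).1
  obtain ⟨a1, a2⟩ := A_derivs A s (a * Complex.exp τ) (hs τ hτ).2.1 hev
  have hskτ := hsk τ
  have hz : a * Complex.exp τ ≠ 0 := mul_ne_zero ha (Complex.exp_ne_zero τ)
  have hkdef : k τ = s (a * Complex.exp τ) * Complex.exp (-((N:ℂ)/2) * τ) / s a := rfl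
  rw [a1, a2, ← (hs τ hτ).1]
  set z := a * Complex.exp τ with hzdef
  set u := s z
  set u1 := deriv s z
  set u2 := deriv (deriv s) z
  set e := Complex.exp (-((N:ℂ)/2) * τ)
  have hene : e ≠ 0 := Complex.exp_ne_zero _
  have hu : u ≠ 0 := by
    intro h; rw [h] at hkdef; exact hkne (by rw [hkdef]; simp)
  set p := deriv k τ / k τ with hp
  set q := deriv (deriv k) τ / k τ with hq
  have hp' : p = u1 * z / u - N / 2 := by
    rw [hp, d1, hkdef]; field_simp
  have hq' : q = (u2 * z ^ 2 + u1 * z - N * u1 * z) / u + N ^ 2 / 4 := by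
    rw [hq, d2, hkdef]; field_simp
  have hNpos : 0 < N := by linarith
  have hρinv : 1 / ρ ≤ N := by rw [div_le_iff₀ hρ]; linarith
  have hpn : ‖p‖ ≤ N / 50 := by
    rw [hp, norm_div, div_le_iff₀ (by linarith)]
    have : (1/100) / ρ = 1/100 * (1/ρ) := by ring
    rw [this] at hc1
    nlinarith
  have hqn : ‖q‖ ≤ N ^ 2 / 25 := by
    rw [hq, norm_div, div_le_iff₀ (by linarith)]
    have : 2 * (1/100) / ρ ^ 2 = 1/50 * (1/ρ) ^ 2 := by ring
    rw [this] at hc2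
    have : (1/ρ) ^ 2 ≤ N ^ 2 := by gcongr
    nlinarith [sq_nonneg N]
  have hal := alg_bound N hN p q hpn hqn
  have hF : (2 * u1 ^ 2 + 2 * u * u2) / (4 * (u ^ 2) ^ 2) - 5 * (2 * u * u1) ^ 2 / (16 * (u ^ 2) ^ 3)
      = (q / 2 - p * ((N:ℂ) / 4 + 1 / 2) - ((N:ℂ) ^ 2 / 16 + N / 4) - 3 / 4 * p ^ 2) / (u * z) ^ 2 := by
    rw [hp', hq']; field_simp; ring
  rw [hF, norm_div, norm_pow]
  set Y := a * s a / ((N/2+1 : ℝ) : ℂ) * Complex.exp (((N/2+1 : ℝ) : ℂ) * τ) with hY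
  have hMne : ((N/2+1 : ℝ) : ℂ) ≠ 0 := by
    have : (N/2+1 : ℝ) ≠ 0 := by positivity
    exact_mod_cast this
  have huz : u * z = Y * k τ * ((N/2+1 : ℝ) : ℂ) := by
    rw [hskτ, hY]
    generalize ((N/2+1 : ℝ) : ℂ) = m at hMne
    field_simp
  have huzn : ‖u * z‖ = ‖Y‖ * ‖k τ‖ * (N/2+1) := by
    rw [huz, norm_mul, norm_mul, Complex.norm_of_nonneg (by positivity)]
  have hZn : ‖Z z‖ ≤ 105/100 * ‖Y‖ := by
    have := norm_sub_norm_le (Z z) Y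
    linarith
  have hZY : N * ‖Z z‖ ≤ 22/10 * ‖u * z‖ := by
    rw [huzn]
    have y0 := norm_nonneg Y
    have b1 : N * ‖Z z‖ ≤ N * (105/100 * ‖Y‖) := by gcongr
    have b2 : ‖Y‖ * (99/100) * (N/2) ≤ ‖Y‖ * ‖k τ‖ * (N/2+1) := by
      gcongr; linarith
    have b3 : 0 ≤ ‖Y‖ * N := by positivity
    nlinarith
  have hZpos : 0 < ‖Z z‖ := norm_pos_iff.2 hZ
  have huzpos : 0 < ‖u * z‖ := norm_pos_iff.2 (mul_ne_zero hu hz)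
  rw [div_le_div_iff₀ (by positivity) (by positivity)]
  have hsq : (N * ‖Z z‖) ^ 2 ≤ (22/10 * ‖u * z‖) ^ 2 := by gcongr
  calc _ ≤ N ^ 2 / 4 * ‖Z z‖ ^ 2 := by gcongr
    _ = (N * ‖Z z‖) ^ 2 / 4 := by ring
    _ ≤ _ := by nlinarith [sq_nonneg ‖u * z‖]

/-- bound on `F₀` in (3.5): for large `r ∈ F₁` and `z` with `Z(z) ∈ J₁`,
`|A''/(4A²) - 5A'²/(16A³)| ≤ 3 |Z(z)|⁻²`. -/
theorem wv_F0_bound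
    (A : ℂ → ℂ) (R : ℝ) (P : Set ℂ)
    (hA : MeroAnnulus A R P) (hess : EssSingAtInfty A P)
    (W : WVData A R) (sqA Z : ℝ → ℂ → ℂ)
    (hZ : ∀ᶠ r in atTop ⊓ Filter.principal W.F1, IsZData W sqA Z r) :
    ∃ r₀ : ℝ, ∀ r ∈ W.F1, r₀ ≤ r →
      ∀ z ∈ WVDisk (W.zr r) (W.N r) (W.phi r) 3,
        Z r z ∈ J1 (WVZr W r) (W.phi r) →
        ‖deriv (deriv A) z / (4 * A z ^ 2)
            - 5 * (deriv A z) ^ 2 / (16 * A z ^ 3)‖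
          ≤ 3 / ‖Z r z‖ ^ 2 := by
  have hrpos : ∀ᶠ r in atTop ⊓ Filter.principal W.F1, (0:ℝ) < r :=
    (eventually_gt_atTop 0).filter_mono inf_le_left
  have hall := (hZ.and (W.approx (1/100) (by norm_num))).and hrpos
  rw [Filter.eventually_inf_principal, Filter.eventually_atTop] at hall
  obtain ⟨r₀, hr₀⟩ := hall
  refine ⟨r₀, ?_⟩
  intro r hr hrr z hz hJ
  obtain ⟨⟨hzd, happ⟩, hr0⟩ := hr₀ r hrr hr
  obtain ⟨τ, rfl, h1, h2⟩ := hz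
  have hN := W.N_ge r hr
  have hφ := W.phi_ge r hr
  have hNpos : 0 < W.N r := by linarith
  have hρ : 0 < W.phi r / W.N r := by positivity
  rw [mul_div_assoc] at h1 h2
  have hτ := sub3 _ τ h1 h2 (Metric.mem_closedBall_self hρ.le)
  have happ' : ∀ τ ∈ sq4 (W.phi r / W.N r),
      ‖A (W.zr r * Complex.exp τ) - Complex.exp ((W.N r : ℂ) * τ) * A (W.zr r)‖
        ≤ 1 / 100 * ‖Complex.exp ((W.N r : ℂ) * τ) * A (W.zr r)‖ := by
    intro t ht
    obtain ⟨t1, t2⟩ := ht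
    refine happ t ?_ ?_ <;> rw [mul_div_assoc] <;> linarith
  by_cases hA0 : A (W.zr r) = 0
  · have := happ' τ hτ
    rw [hA0] at this
    simp only [mul_zero, sub_zero, norm_zero, norm_le_zero_iff] at this
    rw [this]
    simp
    positivity
  · have ha : W.zr r ≠ 0 := by
      rw [← norm_pos_iff, W.zr_abs r hr]; exact hr0
    refine core (W.N r) (W.phi r / W.N r) hN hρ ?_ (W.zr r) ha A (sqA r) (Z r) ?_ ?_ happ' hA0 τ
      h1 h2 hJ.1
    · rw [div_mul_cancel₀ _ hNpos.ne']; exact hφ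
    · intro t ht
      refine hzd.1 _ ⟨t, rfl, ?_, ?_⟩
      · rw [mul_div_assoc]; exact ht.1
      · rw [mul_div_assoc]; exact ht.2
    · have := hzd.2
      simp only [WVwr, mul_div_assoc] at this
      simpa only [mul_div_assoc] using this

end
end

section
/- If E is an ε-set, then the set of r ≥ 1 for which the circle S(0,r) = {z ∈ ℂ : |z| = r} meets E has finite logarithmic measure, i.e. ∫_{{r ≥ 1 : S(0,r) ∩ E ≠ ∅}} dr/r < ∞. -/
open Filter Set Topology Bornology MeasureTheory

noncomputable section

/-- if `E` is an ε-set then the set of `r ≥ 1` for which the circle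
`S(0,r)` meets `E` has finite logarithmic measure. -/
theorem epsilon_set_finite_logarithmic_measure
    (E : Set ℂ) (hE : IsEpsilonSet E) :
    ∫⁻ r in {r : ℝ | 1 ≤ r ∧ ∃ z : ℂ, ‖z‖ = r ∧ z ∈ E},
      ENNReal.ofReal (1 / r) < ⊤ := by
  obtain ⟨b, ρ, hρ, hb, hsum, rfl⟩ := hE
  set S : ℕ → Set ℝ := fun j => Ici 1 ∩ Ioo (‖b j‖ - ρ j) (‖b j‖ + ρ j) with hS
  have hsub : {r : ℝ | 1 ≤ r ∧ ∃ z : ℂ, ‖z‖ = r ∧ z ∈ ⋃ j, Metric.ball (b j) (ρ j)} ⊆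
      ⋃ j, S j := by
    rintro r ⟨hr, z, hz, hzE⟩
    obtain ⟨j, hj⟩ := mem_iUnion.1 hzE
    rw [Metric.mem_ball, dist_eq_norm] at hj
    have h1 := abs_lt.1 ((abs_norm_sub_norm_le z (b j)).trans_lt hj)
    rw [hz] at h1
    exact mem_iUnion.2 ⟨j, hr, by linarith [h1.1], by linarith [h1.2]⟩
  classical
  set c : ℕ → ℝ := fun j =>
    if 0 < ‖b j‖ ∧ ρ j / ‖b j‖ ≤ 1 / 2 then 4 * (ρ j / ‖b j‖) else 2 * ρ j with hc
  have hcsum : Summable c := by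
    have h1 : ∀ᶠ j in atTop, 0 < ‖b j‖ := hb.eventually_gt_atTop 0
    have h2 : ∀ᶠ j in atTop, ρ j / ‖b j‖ ≤ 1 / 2 :=
      hsum.tendsto_atTop_zero.eventually_le_const (by norm_num)
    refine (summable_congr_atTop ?_).2 (hsum.mul_left 4)
    filter_upwards [h1, h2] with j h1 h2
    simp only [hc]
    rw [if_pos ⟨h1, h2⟩]
  have key : ∀ j (K : ℝ), 0 ≤ K → (∀ r ∈ S j, 1 / r ≤ K) →
      ∫⁻ r in S j, ENNReal.ofReal (1 / r) ≤ ENNReal.ofReal (K * (2 * ρ j)) := by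
    intro j K hK h
    have hm : MeasurableSet (S j) := measurableSet_Ici.inter measurableSet_Ioo
    calc ∫⁻ r in S j, ENNReal.ofReal (1 / r)
        ≤ ∫⁻ _ in S j, ENNReal.ofReal K :=
          setLIntegral_mono' hm fun r hr => ENNReal.ofReal_le_ofReal (h r hr)
      _ = ENNReal.ofReal K * volume (S j) := by rw [setLIntegral_const]
      _ ≤ ENNReal.ofReal K * volume (Ioo (‖b j‖ - ρ j) (‖b j‖ + ρ j)) := by
          gcongr
          exact inter_subset_right
      _ = ENNReal.ofReal (K * (2 * ρ j)) := by
          rw [Real.volume_Ioo, ← ENNReal.ofReal_mul hK]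
          congr 1
          ring
  have hbd : ∀ j, ∫⁻ r in S j, ENNReal.ofReal (1 / r) ≤ ENNReal.ofReal (c j) := by
    intro j
    by_cases h : 0 < ‖b j‖ ∧ ρ j / ‖b j‖ ≤ 1 / 2
    · refine (key j (2 / ‖b j‖) (by positivity) ?_).trans_eq ?_
      · rintro r ⟨hr1, hr2, _⟩
        have h3 := (div_le_iff₀ h.1).1 h.2
        have hr0 : (0:ℝ) < r := lt_of_lt_of_le one_pos hr1
        rw [div_le_div_iff₀ hr0 h.1]
        linarith
      · simp only [hc]
        rw [if_pos h]
        congr 1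
        ring
    · refine (key j 1 zero_le_one ?_).trans_eq ?_
      · rintro r ⟨hr1, _⟩
        have hr1' : (1:ℝ) ≤ r := hr1
        rw [div_le_iff₀ (by linarith)]
        linarith
      · simp only [hc]
        rw [if_neg h, one_mul]
  calc _ ≤ ∫⁻ r in ⋃ j, S j, ENNReal.ofReal (1 / r) := lintegral_mono_set hsub
    _ ≤ ∑' j, ∫⁻ r in S j, ENNReal.ofReal (1 / r) := lintegral_iUnion_le _ _
    _ ≤ ∑' j, ENNReal.ofReal (c j) := ENNReal.tsum_le_tsum hbd
    _ < ⊤ := hcsum.tsum_ofReal_lt_top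

end
end
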